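/- Let T be a τ-tilting module over an artin algebra A with I = Ann(T) and Ā = A/I. Then the following are equivalent: (1) T is 1-tilting over A; (2) Ext²_A(T, X) = 0 for all X ∈ fac(T); (3) Ext²_A(T, D(Ā)) = 0; (4) Tor₁^A(I, T) = 0. -/

import Mathlib

open TensorProduct

section BalancedTensor

variable (R A : Type) [CommRing R] [Ring A] [Algebra R A]

/-- The relations defining the balanced tensor product over `A` inside `X ⊗[R] T`. -/
def balRel (X T : Type) [AddCommGroup X] [Module Aᵐᵒᵖ X] [Module R X]
    [AddCommGroup T] [Module A T] [Module R T] : Submodule R (X ⊗[R] T) :=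
  Submodule.span R {z | ∃ (x : X) (a : A) (t : T),
    z = (MulOpposite.op a • x) ⊗ₜ[R] t - x ⊗ₜ[R] (a • t)}

/-- The balanced tensor product `X ⊗[A] T` of a right `A`-module `X` and a
left `A`-module `T`. -/
def balTensor (X T : Type) [AddCommGroup X] [Module Aᵐᵒᵖ X] [Module R X]
    [AddCommGroup T] [Module A T] [Module R T] : Type :=
  (X ⊗[R] T) ⧸ balRel R A X T

noncomputable instance (X T : Type) [AddCommGroup X] [Module Aᵐᵒᵖ X] [Module R X]
    [AddCommGroup T] [Module A T] [Module R T] : AddCommGroup (balTensor R A X T) :=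
  inferInstanceAs (AddCommGroup ((X ⊗[R] T) ⧸ balRel R A X T))

noncomputable instance (X T : Type) [AddCommGroup X] [Module Aᵐᵒᵖ X] [Module R X]
    [AddCommGroup T] [Module A T] [Module R T] : Module R (balTensor R A X T) :=
  inferInstanceAs (Module R ((X ⊗[R] T) ⧸ balRel R A X T))

/-- Functoriality of the balanced tensor product in the second variable. -/
noncomputable def balMap (X : Type) [AddCommGroup X] [Module Aᵐᵒᵖ X] [Module R X]
    {T T' : Type} [AddCommGroup T] [Module A T] [Module R T] [IsScalarTower R A T]
    [AddCommGroup T'] [Module A T'] [Module R T'] [IsScalarTower R A T']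
    (f : T →ₗ[A] T') : balTensor R A X T →ₗ[R] balTensor R A X T' :=
  Submodule.mapQ _ _ (TensorProduct.map LinearMap.id (f.restrictScalars R)) (by
    rw [← Submodule.map_le_iff_le_comap, balRel, Submodule.map_span]
    apply Submodule.span_le.2
    rintro z ⟨w, ⟨x, a, t, rfl⟩, rfl⟩
    apply Submodule.subset_span
    exact ⟨x, a, f t, by simp [TensorProduct.map_tmul, map_smul]⟩)

/-- The kernel of the canonical free presentation `(T →₀ A) → T`. -/
noncomputable def presKer (T : Type) [AddCommGroup T] [Module A T] : Submodule A (T →₀ A) :=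
  LinearMap.ker (Finsupp.linearCombination A (id : T → T))

/-- `Tor₁^A(X, T)`, computed from the canonical free presentation
`0 → K → (T →₀ A) → T → 0` of `T` as the kernel of `X ⊗[A] K → X ⊗[A] (T →₀ A)`. -/
noncomputable def Tor1 (X T : Type) [AddCommGroup X] [Module Aᵐᵒᵖ X] [Module R X]
    [AddCommGroup T] [Module A T] [Module R T] [IsScalarTower R A T] : Type :=
  ↥(LinearMap.ker (balMap R A X (T := ↥(presKer A T)) (T' := (T →₀ A))
      ((presKer A T).subtype)))

noncomputable instance (X T : Type) [AddCommGroup X] [Module Aᵐᵒᵖ X] [Module R X]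
    [AddCommGroup T] [Module A T] [Module R T] [IsScalarTower R A T] :
    AddCommGroup (Tor1 R A X T) :=
  inferInstanceAs (AddCommGroup ↥(LinearMap.ker (balMap R A X (T := ↥(presKer A T))
    (T' := (T →₀ A)) ((presKer A T).subtype))))

noncomputable instance (X T : Type) [AddCommGroup X] [Module Aᵐᵒᵖ X] [Module R X]
    [AddCommGroup T] [Module A T] [Module R T] [IsScalarTower R A T] :
    Module R (Tor1 R A X T) :=
  inferInstanceAs (Module R ↥(LinearMap.ker (balMap R A X (T := ↥(presKer A T))
    (T' := (T →₀ A)) ((presKer A T).subtype))))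

/-- A two-sided ideal regarded as a right submodule of `A`. -/
def rIdeal (I : TwoSidedIdeal A) : Submodule Aᵐᵒᵖ A where
  carrier := I
  add_mem' := I.add_mem
  zero_mem' := I.zero_mem
  smul_mem' := fun a x hx => by simpa using I.mul_mem_right x a.unop hx

instance : IsScalarTower R Aᵐᵒᵖ A :=
  ⟨fun r a x => by
    show x * (r • a).unop = r • (x * a.unop)
    simp [mul_smul_comm]⟩

end BalancedTensor

section Dual

open CategoryTheory

variable (k A : Type) [Field k] [Ring A] [Algebra k A]

/-- Left `A`-module structure on the `k`-dual of `A`, via the right regular action. -/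
noncomputable instance dualModule : Module A (A →ₗ[k] k) where
  smul a f := f.comp (LinearMap.mulRight k a)
  one_smul f := by ext x; show f (x * 1) = f x; rw [mul_one]
  mul_smul a b f := by ext x; show f (x * (a * b)) = f ((x * a) * b); rw [mul_assoc]
  smul_zero a := rfl
  smul_add a f g := rfl
  add_smul a b f := by ext x; show f (x * (a + b)) = f (x * a) + f (x * b); rw [mul_add, map_add]
  zero_smul f := by ext x; show f (x * 0) = 0; rw [mul_zero, map_zero]

/-- The Matlis dual `D(A/I)`, realized as the `A`-submodule of `D(A) = Hom_k(A, k)`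
consisting of the functionals vanishing on `I`. -/
noncomputable def DBar (I : TwoSidedIdeal A) : Submodule A (A →ₗ[k] k) where
  carrier := {f | ∀ x ∈ I, f x = 0}
  add_mem' := fun hf hg x hx => by simp [hf x hx, hg x hx]
  zero_mem' := fun x hx => rfl
  smul_mem' := fun a f hf x hx => hf (x * a) (I.mul_mem_right x a hx)

end Dual

/-- The `n`-th Ext-group `Ext_A^n(M, N)` of left `A`-modules. -/
noncomputable def egrp (A : Type) [Ring A] (n : ℕ) (M N : Type) [AddCommGroup M] [Module A M]
    [AddCommGroup N] [Module A N] : Type :=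
  ((_root_.Ext ℤ (ModuleCat A) n).obj (Opposite.op (ModuleCat.of A M))).obj
    (ModuleCat.of A N)

noncomputable instance (A : Type) [Ring A] (n : ℕ) (M N : Type) [AddCommGroup M] [Module A M]
    [AddCommGroup N] [Module A N] : AddCommGroup (egrp A n M N) :=
  inferInstanceAs (AddCommGroup (((_root_.Ext ℤ (ModuleCat A) n).obj
    (Opposite.op (ModuleCat.of A M))).obj (ModuleCat.of A N)))

section Count

variable (B : Type) [Ring B]

/-- `M` is an indecomposable module. -/
def isIndec (M : Type) [AddCommGroup M] [Module B M] : Prop :=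
  Nontrivial M ∧ ∀ (X Y : Type) [AddCommGroup X] [Module B X] [AddCommGroup Y] [Module B Y],
    Nonempty (M ≃ₗ[B] X × Y) → Subsingleton X ∨ Subsingleton Y

/-- The setoid identifying isomorphic modules satisfying a given predicate. -/
def isoSetoid (pred : ModuleCat B → Prop) : Setoid {N : ModuleCat B // pred N} where
  r X Y := Nonempty (↥X.1 ≃ₗ[B] ↥Y.1)
  iseqv := ⟨fun _ => ⟨LinearEquiv.refl B _⟩, fun ⟨e⟩ => ⟨e.symm⟩, fun ⟨e⟩ ⟨f⟩ => ⟨e.trans f⟩⟩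

/-- `|M|`: the number of isomorphism classes of indecomposable direct summands of `M`. -/
noncomputable def numIndec (M : Type) [AddCommGroup M] [Module B M] : ℕ :=
  Nat.card (Quotient (isoSetoid B (fun N => isIndec B ↥N ∧
    ∃ (s : ↥N →ₗ[B] M) (r : M →ₗ[B] ↥N), r.comp s = LinearMap.id)))

end Count

section Fac

variable (A : Type) [Ring A]

/-- `fac(T)`: the class of factor modules of finite direct sums of copies of `T`. -/
def facP (T : Type) [AddCommGroup T] [Module A T]
    (M : Type) [AddCommGroup M] [Module A M] : Prop :=
  ∃ (n : ℕ) (f : (Fin n → T) →ₗ[A] M), Function.Surjective f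

/-- `M` is a direct summand of `N`. -/
def isSummand (M N : Type) [AddCommGroup M] [Module A M] [AddCommGroup N] [Module A N] :
    Prop :=
  ∃ (s : M →ₗ[A] N) (r : N →ₗ[A] M), r.comp s = LinearMap.id

/-- `add(T)`: direct summands of finite direct sums of copies of `T`. -/
def addP (T : Type) [AddCommGroup T] [Module A T]
    (M : Type) [AddCommGroup M] [Module A M] : Prop :=
  ∃ n : ℕ, isSummand A M (Fin n → T)

/-- The module `T` has projective dimension at most one. -/
def pdLeOne (T : Type) [AddCommGroup T] [Module A T] : Prop :=
  ∃ (P₀ P₁ : ModuleCat.{0} A) (_ : Module.Projective A ↥P₀) (_ : Module.Projective A ↥P₁)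
    (i : ↥P₁ →ₗ[A] ↥P₀) (p : ↥P₀ →ₗ[A] T),
      Function.Injective i ∧ Function.Surjective p ∧ Function.Exact i p

/-- `M` is a projective object of the exact category `fac(T)`. -/
def projInFac (T : Type) [AddCommGroup T] [Module A T]
    (M : Type) [AddCommGroup M] [Module A M] : Prop :=
  facP A T M ∧ ∀ (X Y Z : Type) [AddCommGroup X] [Module A X] [AddCommGroup Y] [Module A Y]
    [AddCommGroup Z] [Module A Z] (i : X →ₗ[A] Y) (p : Y →ₗ[A] Z),
      Function.Injective i → Function.Surjective p → Function.Exact i p →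
      facP A T X → facP A T Y → facP A T Z →
      ∀ g : M →ₗ[A] Z, ∃ h : M →ₗ[A] Y, p.comp h = g

end Fac

/-- `T` is `τ`-rigid, via the Auslander–Smalø criterion `Ext¹_A(T, fac(T)) = 0`. -/
def tauRigid (A : Type) [Ring A] (T : Type) [AddCommGroup T] [Module A T] : Prop :=
  ∀ (M : Type) [AddCommGroup M] [Module A M], facP A T M → Subsingleton (egrp A 1 T M)

section
open CategoryTheory

lemma egrp_subsingleton_iff {A : Type} [Ring A] {M X : Type} [AddCommGroup M] [Module A M]
    [AddCommGroup X] [Module A X] (P : ProjectiveResolution (ModuleCat.of A M)) (n : ℕ) :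
    Subsingleton (egrp A (n+1) M X) ↔
      ∀ f : P.complex.X (n+1) →ₗ[A] X, f ∘ₗ (P.complex.d (n+2) (n+1)).hom = 0 →
        ∃ g : P.complex.X n →ₗ[A] X, g ∘ₗ (P.complex.d (n+1) n).hom = f := by
  have h1 : Subsingleton (egrp A (n+1) M X) ↔ Limits.IsZero
     (((_root_.Ext ℤ (ModuleCat A) (n+1)).obj (Opposite.op (ModuleCat.of A M))).obj
    (ModuleCat.of A X)) := by
    rw [ModuleCat.isZero_iff_subsingleton]; rfl
  rw [h1, (P.isoExt (R := ℤ) (n+1) (ModuleCat.of A X)).isZero_iff, 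
   ← HomologicalComplex.exactAt_iff_isZero_homology, 
   HomologicalComplex.exactAt_iff' _ n (n+1) (n+2) (by simp) (by simp),
   ShortComplex.moduleCat_exact_iff]
  constructor
  · intro h f hf
    obtain ⟨g, hg⟩ := h (ModuleCat.ofHom f) (by
      change (P.complex.d (n+2) (n+1)) ≫ ModuleCat.ofHom f = 0
      ext x
      exact LinearMap.congr_fun hf x)
    refine ⟨ModuleCat.Hom.hom (g : P.complex.X n ⟶ ModuleCat.of A X), ?_⟩
    have : (P.complex.d (n+1) n) ≫ (g : P.complex.X n ⟶ ModuleCat.of A X) = ModuleCat.ofHom f := hg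
    ext x
    exact ConcreteCategory.congr_hom this x
  · intro h f hf
    change P.complex.X (n+1) ⟶ ModuleCat.of A X at f
    change (P.complex.d (n+2) (n+1)) ≫ f = 0 at hf
    obtain ⟨g, hg⟩ := h f.hom (by ext x; exact ConcreteCategory.congr_hom hf x)
    refine ⟨ModuleCat.ofHom g, ?_⟩
    change (P.complex.d (n+1) n) ≫ ModuleCat.ofHom g = f
    ext x
    exact LinearMap.congr_fun hg x

end

section
open CategoryTheory

/-- Elementary form of the vanishing of `Ext¹(M, X)`. -/
def EV (A : Type) [Ring A] (M X : Type) [AddCommGroup M] [Module A M]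
    [AddCommGroup X] [Module A X] : Prop :=
  ∀ (Y Z : Type) [AddCommGroup Y] [Module A Y] [AddCommGroup Z] [Module A Z]
    (i : X →ₗ[A] Y) (q : Y →ₗ[A] Z), Function.Injective i → Function.Surjective q →
    LinearMap.range i = LinearMap.ker q → ∀ f : M →ₗ[A] Z, ∃ g : M →ₗ[A] Y, q ∘ₗ g = f

section
variable {A : Type} [Ring A] {M N X P : Type} [AddCommGroup M] [Module A M]
    [AddCommGroup N] [Module A N]
    [AddCommGroup X] [Module A X] [AddCommGroup P] [Module A P]

/-- factor through a surjection -/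
lemma factor_surj (e : P →ₗ[A] M) (he : Function.Surjective e) (f : P →ₗ[A] X)
    (h : ∀ x, e x = 0 → f x = 0) : ∃ g : M →ₗ[A] X, g ∘ₗ e = f := by
  refine ⟨(LinearMap.ker e).liftQ f (fun x hx => h x hx) ∘ₗ
    (e.quotKerEquivOfSurjective he).symm.toLinearMap, ?_⟩
  ext x
  have : (e.quotKerEquivOfSurjective he).symm (e x) = (LinearMap.ker e).mkQ x := by
    rw [LinearEquiv.symm_apply_eq]; rfl
  rw [LinearMap.comp_apply, LinearMap.comp_apply, LinearEquiv.coe_coe, this]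
  exact (LinearMap.ker e).liftQ_apply f x

/-- corestrict along an injection -/
lemma factor_inj (i : X →ₗ[A] M) (hi : Function.Injective i) (f : P →ₗ[A] M)
    (h : ∀ x, ∃ y, i y = f x) : ∃ g : P →ₗ[A] X, i ∘ₗ g = f := by
  refine ⟨(LinearEquiv.ofInjective i hi).symm.toLinearMap ∘ₗ
    f.codRestrict (LinearMap.range i) (fun x => h x), ?_⟩
  ext x
  have := LinearEquiv.apply_symm_apply (LinearEquiv.ofInjective i hi)
    (f.codRestrict (LinearMap.range i) (fun x => h x) x)
  exact congrArg Subtype.val this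

lemma EV.extend (h : EV A M X) (e : P →ₗ[A] M) (he : Function.Surjective e)
    (f : LinearMap.ker e →ₗ[A] X) : ∃ g : P →ₗ[A] X, g ∘ₗ (LinearMap.ker e).subtype = f := by
  let W : Submodule A (X × P) := LinearMap.range (f.prod (-(LinearMap.ker e).subtype))
  let i : X →ₗ[A] (X × P) ⧸ W := W.mkQ ∘ₗ LinearMap.inl A X P
  let j : P →ₗ[A] (X × P) ⧸ W := W.mkQ ∘ₗ LinearMap.inr A X P
  let q : (X × P) ⧸ W →ₗ[A] M := W.liftQ (e ∘ₗ LinearMap.snd A X P) (by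
    rintro _ ⟨x, rfl⟩
    simp)
  have hi : Function.Injective i := by
    rw [injective_iff_map_eq_zero]
    intro x hx
    have : LinearMap.inl A X P x ∈ W := by simpa [i] using hx
    obtain ⟨n, hn⟩ := this
    have h1 := congrArg Prod.fst hn
    have h2 := congrArg Prod.snd hn
    simp at h1 h2
    rw [← h1, h2, map_zero]
  have hq : Function.Surjective q := by
    intro m
    obtain ⟨p, rfl⟩ := he m
    exact ⟨j p, by simp [q, j]⟩
  have hqj : ∀ p, q (j p) = e p := fun p => by simp [q, j]
  have hij : ∀ n : LinearMap.ker e, j n = i (f n) := by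
    intro n
    have : (f n, -(n : P)) ∈ W := ⟨n, by simp⟩
    have h0 : W.mkQ (f n, -(n:P)) = 0 := by simpa using this
    have h1 : (f n, -(n:P)) = LinearMap.inl A X P (f n) - LinearMap.inr A X P n := by
      ext <;> simp
    rw [h1, map_sub, sub_eq_zero] at h0
    exact h0.symm
  have hex : LinearMap.range i = LinearMap.ker q := by
    apply le_antisymm
    · rintro _ ⟨x, rfl⟩
      simp [i, q]
    · intro y hy
      obtain ⟨⟨x, p⟩, rfl⟩ := W.mkQ_surjective y
      have hp : e p = 0 := by simpa [q] using hy
      refine ⟨x + f ⟨p, hp⟩, ?_⟩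
      rw [map_add, ← hij]
      simp only [i, j, LinearMap.comp_apply]
      rw [← map_add]
      simp
  obtain ⟨s, hs⟩ := h _ _ i q hi hq hex LinearMap.id
  obtain ⟨g, hg⟩ := factor_inj i hi (j - s ∘ₗ e) (by
    intro x
    have : (j - s ∘ₗ e) x ∈ LinearMap.ker q := by
      have := LinearMap.congr_fun hs (e x)
      simp at this
      simp [hqj, this]
    rw [← hex] at this
    exact this)
  refine ⟨g, ?_⟩
  ext n
  apply hi
  have := LinearMap.congr_fun hg n
  simp at this
  simp [this, hij]

lemma EV.of_extend [Module.Projective A P] (e : P →ₗ[A] M) (he : Function.Surjective e)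
    (h : ∀ f : LinearMap.ker e →ₗ[A] X, ∃ g : P →ₗ[A] X, g ∘ₗ (LinearMap.ker e).subtype = f) :
    EV A M X := by
  intro Y Z _ _ _ _ i q hi hq hex f
  obtain ⟨u, hu⟩ := Module.projective_lifting_property q (f ∘ₗ e) hq
  obtain ⟨v, hv⟩ := factor_inj i hi (u ∘ₗ (LinearMap.ker e).subtype) (by
    intro x
    have : u x ∈ LinearMap.ker q := by
      have := LinearMap.congr_fun hu x
      simpa using this
    rw [← hex] at this
    exact this)
  obtain ⟨g, hg⟩ := h v
  obtain ⟨w, hw⟩ := factor_surj e he (u - i ∘ₗ g) (by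
    intro x hx
    have h1 := LinearMap.congr_fun hg ⟨x, hx⟩
    have h2 := LinearMap.congr_fun hv ⟨x, hx⟩
    simp at h1 h2
    simp [h1, h2])
  refine ⟨w, ?_⟩
  ext m
  obtain ⟨p, rfl⟩ := he m
  have h1 := LinearMap.congr_fun hw p
  have h2 := LinearMap.congr_fun hu p
  have h3 : i (g p) ∈ LinearMap.ker q := hex ▸ ⟨_, rfl⟩
  simp at h1 h2 h3
  simp [h1, h2, h3]

lemma EV.retract (h : EV A M X) (s : N →ₗ[A] M) (r : M →ₗ[A] N) (hrs : r ∘ₗ s = LinearMap.id) :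
    EV A N X := by
  intro Y Z _ _ _ _ i q hi hq hex f
  obtain ⟨g, hg⟩ := h Y Z i q hi hq hex (f ∘ₗ r)
  refine ⟨g ∘ₗ s, ?_⟩
  rw [← LinearMap.comp_assoc, hg, LinearMap.comp_assoc, hrs]; rfl

lemma EV.of_projective [Module.Projective A P] : EV A P X := by
  intro Y Z _ _ _ _ i q hi hq hex f
  exact Module.projective_lifting_property q f hq

lemma EV.prod (h : EV A M X) (h' : EV A N X) : EV A (M × N) X := by
  intro Y Z _ _ _ _ i q hi hq hex f
  obtain ⟨g, hg⟩ := h Y Z i q hi hq hex (f ∘ₗ LinearMap.inl A M N)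
  obtain ⟨g', hg'⟩ := h' Y Z i q hi hq hex (f ∘ₗ LinearMap.inr A M N)
  refine ⟨g.coprod g', ?_⟩
  rw [LinearMap.comp_coprod, hg, hg']
  ext <;> simp

lemma EV.congr_right {X' : Type} [AddCommGroup X'] [Module A X'] (h : EV A M X)
    (e : X ≃ₗ[A] X') : EV A M X' := by
  intro Y Z _ _ _ _ i q hi hq hex f
  refine h Y Z (i ∘ₗ e.toLinearMap) q (hi.comp e.injective) hq ?_ f
  rw [LinearMap.range_comp, LinearEquiv.range, Submodule.map_top, hex]

/-- Schanuel type comparison -/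
lemma schanuel {P' : Type} [AddCommGroup P'] [Module A P'] [Module.Projective A P]
    [Module.Projective A P'] (e : P →ₗ[A] M) (he : Function.Surjective e)
    (e' : P' →ₗ[A] M) (he' : Function.Surjective e') :
    ∃ (s : LinearMap.ker e →ₗ[A] P × LinearMap.ker e') (r : P × LinearMap.ker e' →ₗ[A] LinearMap.ker e),
      r ∘ₗ s = LinearMap.id := by
  obtain ⟨u, hu⟩ := Module.projective_lifting_property e' e he'
  obtain ⟨v, hv⟩ := Module.projective_lifting_property e e' he
  have hu' := LinearMap.congr_fun hu
  have hv' := LinearMap.congr_fun hv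
  simp only [LinearMap.comp_apply] at hu' hv'
  refine ⟨(LinearMap.ker e).subtype.prod
    ((u ∘ₗ (LinearMap.ker e).subtype).codRestrict (LinearMap.ker e') ?_),
    LinearMap.codRestrict (LinearMap.ker e)
      ((LinearMap.id - v ∘ₗ u).coprod (v ∘ₗ (LinearMap.ker e').subtype)) ?_, ?_⟩
  · intro c; simp [hu']
  · intro c; simp [hu', hv']
  · ext x
    change (x : P) - v (u x) + v (u x) = x
    abel

lemma EV.ker_congr {P' : Type} [AddCommGroup P'] [Module A P'] [Module.Projective A P]
    [Module.Projective A P'] (e : P →ₗ[A] M) (he : Function.Surjective e)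
    (e' : P' →ₗ[A] M) (he' : Function.Surjective e') (h : EV A (LinearMap.ker e') X) :
    EV A (LinearMap.ker e) X := by
  obtain ⟨s, r, hrs⟩ := schanuel e he e' he'
  exact (EV.prod EV.of_projective h).retract s r hrs

lemma complex_extend_iff {P₁ P₂ : Type} [AddCommGroup P₁] [Module A P₁] [AddCommGroup P₂] [Module A P₂]
    (d₁ : P₁ →ₗ[A] P) (d₂ : P₂ →ₗ[A] P₁) (hex : LinearMap.range d₂ = LinearMap.ker d₁)
    (e : P →ₗ[A] M) (hex' : LinearMap.range d₁ = LinearMap.ker e) :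
    (∀ f : P₁ →ₗ[A] X, f ∘ₗ d₂ = 0 → ∃ g : P →ₗ[A] X, g ∘ₗ d₁ = f) ↔
    ∀ f : LinearMap.ker e →ₗ[A] X, ∃ g : P →ₗ[A] X, g ∘ₗ (LinearMap.ker e).subtype = f := by
  let d : P₁ →ₗ[A] LinearMap.ker e := d₁.codRestrict _ (fun x => hex' ▸ ⟨x, rfl⟩)
  have hd : Function.Surjective d := by
    rintro ⟨x, hx⟩
    rw [← hex'] at hx
    obtain ⟨y, rfl⟩ := hx
    exact ⟨y, rfl⟩
  constructor
  · intro h f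
    obtain ⟨g, hg⟩ := h (f ∘ₗ d) (by
      ext x
      have : d (d₂ x) = 0 := by
        apply Subtype.ext
        have : d₂ x ∈ LinearMap.ker d₁ := hex ▸ ⟨x, rfl⟩
        exact this
      simp [this])
    refine ⟨g, ?_⟩
    ext x
    obtain ⟨y, rfl⟩ := hd x
    exact LinearMap.congr_fun hg y
  · intro h f hf
    obtain ⟨f', hf'⟩ := factor_surj d hd f (by
      intro x hx
      have : x ∈ LinearMap.ker d₁ := congrArg Subtype.val hx
      rw [← hex] at this
      obtain ⟨y, rfl⟩ := this
      exact LinearMap.congr_fun hf y)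
    obtain ⟨g, hg⟩ := h f'
    refine ⟨g, ?_⟩
    rw [← hf', ← hg]
    rfl

end

section
variable {A : Type} [Ring A] (M X : Type) [AddCommGroup M] [Module A M]
    [AddCommGroup X] [Module A X]

lemma res_data (Q : ProjectiveResolution (ModuleCat.of A M)) :
    ∃ e : Q.complex.X 0 →ₗ[A] M, Function.Surjective e ∧
      LinearMap.range (Q.complex.d 1 0).hom = LinearMap.ker e := by
  have h := Q.exact₀
  refine ⟨(Q.π.f 0).hom, ?_, ?_⟩
  · exact (ModuleCat.epi_iff_surjective (Q.π.f 0)).1 inferInstance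
  · exact h.moduleCat_range_eq_ker

lemma ext1_iff : Subsingleton (egrp A 1 M X) ↔ EV A M X := by
  let Q := projectiveResolution (ModuleCat.of A M)
  obtain ⟨e, he, hex⟩ := res_data M Q
  have := (Q.exact_succ 0).moduleCat_range_eq_ker
  rw [egrp_subsingleton_iff Q 0,
    complex_extend_iff (Q.complex.d 1 0).hom (Q.complex.d 2 1).hom this e hex]
  have : Module.Projective A (Q.complex.X 0) :=
    (IsProjective.iff_projective _).2 (Q.projective 0)
  exact ⟨fun h => EV.of_extend e he h, fun h f => h.extend e he f⟩

lemma ext2_iff {P : Type} [AddCommGroup P] [Module A P] [Module.Projective A P] (e : P →ₗ[A] M)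
    (he : Function.Surjective e) :
    Subsingleton (egrp A 2 M X) ↔ EV A (LinearMap.ker e) X := by
  let Q := projectiveResolution (ModuleCat.of A M)
  obtain ⟨e', he', hex⟩ := res_data M Q
  have h1 := (Q.exact_succ 0).moduleCat_range_eq_ker
  have h2 := (Q.exact_succ 1).moduleCat_range_eq_ker
  have : Module.Projective A (Q.complex.X 0) :=
    (IsProjective.iff_projective _).2 (Q.projective 0)
  have : Module.Projective A (Q.complex.X 1) :=
    (IsProjective.iff_projective _).2 (Q.projective 1)
  have key : Subsingleton (egrp A 2 M X) ↔ EV A (LinearMap.ker e') X := by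
    let d : Q.complex.X 1 →ₗ[A] LinearMap.ker e' :=
      (Q.complex.d 1 0).hom.codRestrict _ (fun x => hex ▸ ⟨x, rfl⟩)
    have hd : Function.Surjective d := by
      rintro ⟨x, hx⟩
      rw [← hex] at hx
      obtain ⟨y, rfl⟩ := hx
      exact ⟨y, rfl⟩
    have hk : LinearMap.ker d = LinearMap.ker (Q.complex.d 1 0).hom := LinearMap.ker_codRestrict ..
    rw [egrp_subsingleton_iff Q 1,
      complex_extend_iff (Q.complex.d 2 1).hom (Q.complex.d 3 2).hom h2 d (hk ▸ h1)]
    exact ⟨fun h => EV.of_extend d hd h, fun h f => h.extend d hd f⟩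
  rw [key]
  exact ⟨fun h => EV.ker_congr e he e' he' h, fun h => EV.ker_congr e' he' e he h⟩

lemma ext2_of_pd (h : pdLeOne A M) : Subsingleton (egrp A 2 M X) := by
  obtain ⟨P₀, P₁, _, _, i, p, hi, hp, hex⟩ := h
  rw [ext2_iff M X p hp]
  have : LinearMap.ker p = LinearMap.range i := LinearMap.exact_iff.1 hex
  rw [this]
  have := Module.Projective.of_equiv (LinearEquiv.ofInjective i hi)
  exact EV.of_projective

end

end

section
open CategoryTheory

section
variable {A : Type} [Ring A] {T M N : Type} [AddCommGroup T] [Module A T]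
    [AddCommGroup M] [Module A M] [AddCommGroup N] [Module A N]

lemma facP.surj (h : facP A T M) (f : M →ₗ[A] N) (hf : Function.Surjective f) : facP A T N := by
  obtain ⟨n, g, hg⟩ := h
  exact ⟨n, f ∘ₗ g, hf.comp hg⟩

lemma facP.iSup_eq (h : facP A T M) : (⨆ f : T →ₗ[A] M, LinearMap.range f) = ⊤ := by
  obtain ⟨n, g, hg⟩ := h
  rw [eq_top_iff]
  rintro m -
  obtain ⟨t, rfl⟩ := hg m
  have : t = ∑ i, LinearMap.single A (fun _ : Fin n => T) i (t i) := by
    simp [LinearMap.single_apply, Finset.univ_sum_single]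
  rw [this, map_sum]
  refine Submodule.sum_mem _ fun i _ => ?_
  exact Submodule.mem_iSup_of_mem (g ∘ₗ LinearMap.single A (fun _ : Fin n => T) i) ⟨t i, rfl⟩

lemma facP_of_iSup [Module.Finite A M] (h : (⨆ f : T →ₗ[A] M, LinearMap.range f) = ⊤) :
    facP A T M := by
  have hc : IsCompactElement (⊤ : Submodule A M) :=
    (Submodule.fg_iff_compact _).1 Module.Finite.fg_top
  obtain ⟨s, hs⟩ := CompleteLattice.IsCompactElement.exists_finset_of_le_iSup _ hc (fun f : T →ₗ[A] M => LinearMap.range f) h.ge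
  refine ⟨s.card, ∑ i, (s.equivFin.symm i : T →ₗ[A] M) ∘ₗ LinearMap.proj i, ?_⟩
  rw [← LinearMap.range_eq_top, eq_top_iff]
  refine hs.trans ?_
  refine iSup₂_le fun f hf => ?_
  rintro _ ⟨t, rfl⟩
  refine ⟨Pi.single (s.equivFin ⟨f, hf⟩) t, ?_⟩
  rw [LinearMap.sum_apply, Finset.sum_eq_single (s.equivFin ⟨f, hf⟩)]
  · simp
  · intro b _ hb
    simp [Pi.single_eq_of_ne hb]
  · simp

lemma facP_pi (h : facP A T M) (hN : Module.Finite A M) (n : ℕ) : facP A T (Fin n → M) := by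
  apply facP_of_iSup
  rw [eq_top_iff]
  rintro m -
  have : m = ∑ i, LinearMap.single A (fun _ : Fin n => M) i (m i) := by
    simp [LinearMap.single_apply, Finset.univ_sum_single]
  rw [this]
  refine Submodule.sum_mem _ fun i _ => ?_
  have h1 : m i ∈ (⨆ f : T →ₗ[A] M, LinearMap.range f) := h.iSup_eq ▸ trivial
  have h2 := Submodule.mem_map_of_mem (f := LinearMap.single A (fun _ : Fin n => M) i) h1
  rw [Submodule.map_iSup] at h2
  revert h2
  refine fun h2 => SetLike.le_def.1 (iSup_le fun f => ?_) h2
  rw [← LinearMap.range_comp]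
  exact le_iSup (fun f : T →ₗ[A] (Fin n → M) => LinearMap.range f) _

lemma facP.finite (h : facP A T M) [Module.Finite A T] : Module.Finite A M := by
  obtain ⟨n, g, hg⟩ := h
  exact Module.Finite.of_surjective g hg
end

section
variable (k A : Type) [Field k] [Ring A] [Algebra k A]

instance dual_tower : IsScalarTower k A (A →ₗ[k] k) :=
  ⟨fun r a f => by
    ext x
    change f (x * (r • a)) = r • f (x * a)
    rw [mul_smul_comm, map_smul]⟩

variable {k A}
variable {X : Type} [AddCommGroup X] [Module A X] [Module k X] [IsScalarTower k A X]

/-- the map to the dual given by a functional -/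
noncomputable def toDual (ψ : X →ₗ[k] k) : X →ₗ[A] (A →ₗ[k] k) where
  toFun x :=
    { toFun := fun b => ψ (b • x)
      map_add' := fun a b => by rw [add_smul, map_add]
      map_smul' := fun r b => by rw [smul_assoc, map_smul]; rfl }
  map_add' x y := by ext b; simp
  map_smul' a x := by
    ext b
    change ψ (b • a • x) = ψ ((b * a) • x)
    rw [mul_smul]

lemma toDual_apply (ψ : X →ₗ[k] k) (x : X) (b : A) : toDual ψ x b = ψ (b • x) := rfl

noncomputable def toDBar (I : TwoSidedIdeal A) (hX : ∀ a ∈ I, ∀ x : X, a • x = 0) (ψ : X →ₗ[k] k) :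
    X →ₗ[A] DBar k A I :=
  (toDual ψ).codRestrict (DBar k A I) (fun x a ha => by rw [toDual_apply, hX a ha, map_zero])

variable (k) in
/-- a type synonym for `DBar` with clean instances -/
def DB (I : TwoSidedIdeal A) : Type := ↥(DBar k A I)

noncomputable instance (I : TwoSidedIdeal A) : AddCommGroup (DB k I) :=
  inferInstanceAs (AddCommGroup (DBar k A I))

noncomputable instance (I : TwoSidedIdeal A) : Module A (DB k I) :=
  inferInstanceAs (Module A (DBar k A I))

variable (k) in
noncomputable def DBe (I : TwoSidedIdeal A) : DB k I ≃ₗ[A] DBar k A I := LinearEquiv.refl A _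

lemma embed_DB [Module.Finite k X] (I : TwoSidedIdeal A) (hX : ∀ a ∈ I, ∀ x : X, a • x = 0) :
    ∃ (n : ℕ) (j : X →ₗ[A] (Fin n → DB k I)), Function.Injective j := by
  let b := Module.finBasis k X
  refine ⟨_, LinearMap.pi (fun i => (DBe k I).symm.toLinearMap ∘ₗ toDBar I hX (b.coord i)), ?_⟩
  rw [injective_iff_map_eq_zero]
  intro x hx
  apply b.ext_elem
  intro i
  have h1 := congrFun hx i
  have h2 := LinearMap.congr_fun (congrArg Subtype.val h1) (1 : A)
  change b.coord i ((1 : A) • x) = 0 at h2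
  rw [one_smul] at h2
  simpa using h2

variable (k) in
lemma DBar_facP [Module.Finite k A] (T : Type) [AddCommGroup T] [Module A T] [Module k T]
    [IsScalarTower k A T] (I : TwoSidedIdeal A)
    (hI : ∀ a : A, a ∈ I ↔ ∀ t : T, a • t = 0) :
    Module.Finite A (DBar k A I) ∧ facP A T (DBar k A I) := by
  have hn : IsNoetherian A (A →ₗ[k] k) := isNoetherian_of_tower k inferInstance
  have hfin : Module.Finite A (DBar k A I) := inferInstance
  refine ⟨hfin, ?_⟩
  apply facP_of_iSup
  have hT : ∀ a ∈ I, ∀ t : T, a • t = 0 := fun a ha => (hI a).1 ha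
  let S := ⨆ f : T →ₗ[A] DBar k A I, LinearMap.range f
  let W : Submodule k (Module.Dual k A) :=
    Submodule.span k {φ | ∃ (ψ : T →ₗ[k] k) (t : T), φ = toDual (A := A) ψ t}
  have hW : ∀ φ ∈ W, φ ∈ S.map (DBar k A I).subtype := by
    intro φ hφ
    induction hφ using Submodule.span_induction with
    | mem x h =>
      obtain ⟨ψ, t, rfl⟩ := h
      refine ⟨toDBar I hT ψ t, ?_, rfl⟩
      exact Submodule.mem_iSup_of_mem (toDBar I hT ψ) ⟨t, rfl⟩
    | zero => exact Submodule.zero_mem _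
    | add x y _ _ hx hy => exact Submodule.add_mem _ hx hy
    | smul a x _ hx =>
      have : a • x = (algebraMap k A a) • (x : A →ₗ[k] k) := by rw [algebraMap_smul]
      rw [this]
      exact Submodule.smul_mem _ _ hx
  rw [eq_top_iff]
  rintro ⟨f, hf⟩ -
  have : f ∈ W := by
    have h1 : W.dualCoannihilator.dualAnnihilator = W := Subspace.dualCoannihilator_dualAnnihilator_eq
    rw [← h1, Submodule.mem_dualAnnihilator]
    intro a ha
    apply hf
    rw [hI]
    intro t
    rw [← Module.forall_dual_apply_eq_zero_iff k]
    intro ψ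
    rw [Submodule.mem_dualCoannihilator] at ha
    exact ha _ (Submodule.subset_span ⟨ψ, t, rfl⟩)
  obtain ⟨y, hy, hyf⟩ := hW f this
  have : y = ⟨f, hf⟩ := Subtype.ext hyf
  rwa [← this]

variable (k) in
lemma DB_facP [Module.Finite k A] (T : Type) [AddCommGroup T] [Module A T] [Module k T]
    [IsScalarTower k A T] (I : TwoSidedIdeal A)
    (hI : ∀ a : A, a ∈ I ↔ ∀ t : T, a • t = 0) :
    Module.Finite A (DB k I) ∧ facP A T (DB k I) := by
  obtain ⟨h1, h2⟩ := DBar_facP k T I hI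
  exact ⟨Module.Finite.equiv (DBe k I).symm,
    h2.surj (DBe k I).symm.toLinearMap (DBe k I).symm.surjective⟩

end

end

section
open CategoryTheory

section
variable {A : Type} [Ring A] {T M N X P E : Type} [AddCommGroup T] [Module A T]
    [AddCommGroup M] [Module A M] [AddCommGroup N] [Module A N] [AddCommGroup X] [Module A X]
    [AddCommGroup P] [Module A P] [AddCommGroup E] [Module A E]

lemma cover_surj : Function.Surjective (Finsupp.linearCombination A (id : N → N)) :=
  Finsupp.linearCombination_id_surjective A N

lemma EV.les [Module.Projective A P] (e : P →ₗ[A] T) (he : Function.Surjective e)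
    (j : X →ₗ[A] E) (hj : Function.Injective j) (h2 : EV A (LinearMap.ker e) E)
    (h1 : EV A T (E ⧸ LinearMap.range j)) : EV A (LinearMap.ker e) X := by
  refine EV.of_extend (Finsupp.linearCombination A (id : LinearMap.ker e → LinearMap.ker e))
    cover_surj ?_
  generalize hδ : Finsupp.linearCombination A (id : LinearMap.ker e → LinearMap.ker e) = δ
  intro h
  have hδs : Function.Surjective δ := hδ ▸ cover_surj
  obtain ⟨g, hg⟩ := h2.extend δ hδs (j ∘ₗ h)
  obtain ⟨u, hu⟩ := factor_surj δ hδs ((LinearMap.range j).mkQ ∘ₗ g) (by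
    intro x hx
    have := LinearMap.congr_fun hg ⟨x, hx⟩
    simp at this
    simp [this])
  obtain ⟨u', hu'⟩ := h1.extend e he u
  obtain ⟨w, hw⟩ := Module.projective_lifting_property (LinearMap.range j).mkQ u'
    (Submodule.mkQ_surjective _)
  obtain ⟨v, hv⟩ := factor_inj j hj (g - w ∘ₗ (LinearMap.ker e).subtype ∘ₗ δ) (by
    intro x
    have h1 := LinearMap.congr_fun hu x
    have h2 := LinearMap.congr_fun hu' (δ x)
    have h3 := LinearMap.congr_fun hw (δ x)
    simp only [LinearMap.comp_apply, Submodule.subtype_apply] at h1 h2 h3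
    have : (LinearMap.range j).mkQ (g x - w (δ x)) = 0 := by
      rw [map_sub, ← h1, ← h2, h3, sub_self]
    have : g x - w (δ x) ∈ LinearMap.range j := by
      simpa only [Submodule.mkQ_apply, Submodule.Quotient.mk_eq_zero] using this
    exact this)
  refine ⟨v, ?_⟩
  ext x
  apply hj
  have h1 := LinearMap.congr_fun hv x
  have h2 := LinearMap.congr_fun hg x
  have h3 : δ x = 0 := x.2
  simp only [LinearMap.comp_apply, Submodule.subtype_apply, LinearMap.sub_apply, h3, map_zero,
    sub_zero] at h1 h2 ⊢
  rw [h1, h2]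

lemma EV.devissage (X' : Submodule A X) (h1 : EV A N X') (h2 : EV A N (X ⧸ X')) : EV A N X := by
  intro Y Z _ _ _ _ i q hi hq hex f
  let L := X'.map i
  let q' : (Y ⧸ L) →ₗ[A] Z := L.liftQ q (by
    refine le_trans ?_ hex.le
    exact LinearMap.map_le_range)
  have hqi : ∀ x, q (i x) = 0 := fun x => by
    have : i x ∈ LinearMap.ker q := hex ▸ ⟨x, rfl⟩
    exact this
  have hLi : ∀ x, i x ∈ L ↔ x ∈ X' := by
    intro x
    constructor
    · rintro ⟨y, hy, hyx⟩
      rwa [← hi hyx]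
    · intro hx; exact ⟨x, hx, rfl⟩
  let i' : (X ⧸ X') →ₗ[A] (Y ⧸ L) := X'.mapQ L i (fun x hx => (hLi x).2 hx)
  obtain ⟨g, hg⟩ := h2 (Y ⧸ L) Z i' q' (by
      rw [injective_iff_map_eq_zero]
      intro x hx
      obtain ⟨x, rfl⟩ := X'.mkQ_surjective x
      have : i x ∈ L := by simpa [i'] using hx
      simpa using (hLi x).1 this)
    (by
      intro z
      obtain ⟨y, rfl⟩ := hq z
      exact ⟨L.mkQ y, by simp [q']⟩)
    (by
      apply le_antisymm
      · rintro _ ⟨x, rfl⟩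
        obtain ⟨x, rfl⟩ := X'.mkQ_surjective x
        simp [i', q', hqi]
      · intro y hy
        obtain ⟨y, rfl⟩ := L.mkQ_surjective y
        have : y ∈ LinearMap.ker q := by simpa [q'] using hy
        rw [← hex] at this
        obtain ⟨x, rfl⟩ := this
        exact ⟨X'.mkQ x, by simp [i']⟩) f
  obtain ⟨g', hg'⟩ := h1 Y (Y ⧸ L) (i ∘ₗ X'.subtype) L.mkQ (hi.comp Subtype.val_injective)
    L.mkQ_surjective (by
      rw [LinearMap.range_comp, Submodule.range_subtype, Submodule.ker_mkQ]) g
  refine ⟨g', ?_⟩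
  rw [← hg, ← hg']
  ext x
  simp [q']

lemma EV.pi {n : ℕ} (h : EV A N X) : EV A N (Fin n → X) := by
  refine EV.of_extend (Finsupp.linearCombination A (id : N → N)) cover_surj ?_
  intro f
  choose g hg using fun i => h.extend (Finsupp.linearCombination A (id : N → N)) cover_surj
    (LinearMap.proj i ∘ₗ f)
  refine ⟨LinearMap.pi g, ?_⟩
  ext x i
  exact LinearMap.congr_fun (hg i) x

lemma EV.of_subsingleton [Subsingleton X] : EV A N X := by
  refine EV.of_extend (Finsupp.linearCombination A (id : N → N)) cover_surj ?_
  intro f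
  exact ⟨0, by ext x; exact Subsingleton.elim _ _⟩

lemma EV.of_finiteLength (h : ∀ (S : Type) [AddCommGroup S] [Module A S], IsSimpleModule A S →
    EV A N S) (hX : IsFiniteLength A X) : EV A N X := by
  induction hX with
  | of_subsingleton => exact EV.of_subsingleton
  | of_simple_quotient _ ih => exact EV.devissage _ ih (h _ inferInstance)

lemma pd_of_EV [IsNoetherianRing A] [Module.Finite A T]
    (h : ∀ (n : ℕ) (e : (Fin n → A) →ₗ[A] T), Function.Surjective e →
      ∀ (X : Type) [AddCommGroup X] [Module A X], Module.Finite A X →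
      EV A (LinearMap.ker e) X) : pdLeOne A T := by
  obtain ⟨n, e, he⟩ := Module.Finite.exists_fin' A T
  obtain ⟨m, d, hd⟩ := Module.Finite.exists_fin' A (LinearMap.ker e)
  have hh := h n e he (LinearMap.ker d) inferInstance
  obtain ⟨s, hs⟩ := hh _ _ (LinearMap.ker d).subtype d Subtype.val_injective hd
    (Submodule.range_subtype _) LinearMap.id
  have : Module.Projective A (LinearMap.ker e) := Module.Projective.of_split s d hs
  refine ⟨ModuleCat.of A (Fin n → A), ModuleCat.of A (LinearMap.ker e), 
    (inferInstance : Module.Projective A (Fin n → A)), this,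
    (LinearMap.ker e).subtype, e, Subtype.val_injective, he, ?_⟩
  exact LinearMap.exact_subtype_ker_map e
end

section
variable {k A : Type} [Field k] [Ring A] [Algebra k A] [Module.Finite k A]

variable (k) in
lemma EV_of_killed (T : Type) [AddCommGroup T] [Module A T] [Module.Finite A T]
    [Module k T] [IsScalarTower k A T]
    (I : TwoSidedIdeal A) (hI : ∀ a : A, a ∈ I ↔ ∀ t : T, a • t = 0)
    (hrig : ∀ (M : Type) [AddCommGroup M] [Module A M], facP A T M → EV A T M)
    {P : Type} [AddCommGroup P] [Module A P] [Module.Projective A P]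
    (e : P →ₗ[A] T) (he : Function.Surjective e)
    (h : EV A (LinearMap.ker e) (DB k I))
    (S : Type) [AddCommGroup S] [Module A S] [Module k S] [IsScalarTower k A S]
    [Module.Finite k S] (hS : ∀ a ∈ I, ∀ s : S, a • s = 0) : EV A (LinearMap.ker e) S := by
  obtain ⟨m, j, hj⟩ := embed_DB (k := k) I hS
  obtain ⟨hfin, hfac⟩ := DB_facP k T I hI
  have h1 : EV A (LinearMap.ker e) (Fin m → DB k I) := EV.pi h
  refine EV.les e he j hj h1 (hrig _ ?_)
  exact (facP_pi hfac hfin m).surj (LinearMap.range j).mkQ (Submodule.mkQ_surjective _)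

variable (k) in
lemma pd_of_ext2_DBar (T : Type) [AddCommGroup T] [Module A T] [Module.Finite A T]
    [Module k T] [IsScalarTower k A T]
    (I : TwoSidedIdeal A) (hI : ∀ a : A, a ∈ I ↔ ∀ t : T, a • t = 0)
    (hrig : ∀ (M : Type) [AddCommGroup M] [Module A M], facP A T M → EV A T M)
    (hS : ∀ (S : Type) [AddCommGroup S] [Module A S], IsSimpleModule A S →
      ∀ a ∈ I, ∀ s : S, a • s = 0)
    (h : Subsingleton (egrp A 2 T (DBar k A I))) : pdLeOne A T := by
  have : IsNoetherianRing A := isNoetherian_of_tower k inferInstance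
  have : IsArtinianRing A := isArtinian_of_tower k inferInstance
  apply pd_of_EV
  intro n e he X _ _ hX
  have h' := ((ext2_iff T _ e he).1 h).congr_right (DBe k I).symm
  have hfl : IsFiniteLength A X :=
    isFiniteLength_iff_isNoetherian_isArtinian.2 ⟨inferInstance, inferInstance⟩
  refine EV.of_finiteLength ?_ hfl
  intro S _ _ hs
  let _ : Module k S := Module.compHom S (algebraMap k A)
  have : IsScalarTower k A S := IsScalarTower.of_algebraMap_smul fun r x => rfl
  have : Module.Finite k S := Module.Finite.trans A S
  exact EV_of_killed k T I hI hrig e he h' S (hS S hs)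
end

end

section
open CategoryTheory TensorProduct

section
variable {k A : Type} [Field k] [Ring A] [Algebra k A]

section
variable {X M N : Type} [AddCommGroup X] [Module Aᵐᵒᵖ X] [Module k X]
  [AddCommGroup M] [Module A M] [Module k M] [IsScalarTower k A M]
  [AddCommGroup N] [Module A N] [Module k N] [IsScalarTower k A N]

variable (k A) in
/-- pure balanced tensors -/
noncomputable def bt (x : X) (m : M) : balTensor k A X M :=
  (balRel k A X M).mkQ (x ⊗ₜ[k] m)

lemma bt_add (x : X) (m m' : M) : bt k A x (m + m') = bt k A x m + bt k A x m' := by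
  rw [bt, TensorProduct.tmul_add, map_add]; rfl

lemma bt_zero (x : X) : bt k A x (0 : M) = 0 := by
  rw [bt, TensorProduct.tmul_zero, map_zero]; rfl

lemma add_bt (x x' : X) (m : M) : bt k A (x + x') m = bt k A x m + bt k A x' m := by
  rw [bt, TensorProduct.add_tmul, map_add]; rfl

lemma zero_bt (m : M) : bt k A (0 : X) m = 0 := by
  rw [bt, TensorProduct.zero_tmul, map_zero]; rfl

lemma bt_bal (x : X) (a : A) (m : M) : bt k A (MulOpposite.op a • x) m = bt k A x (a • m) := by
  have : (MulOpposite.op a • x) ⊗ₜ[k] m - x ⊗ₜ[k] (a • m) ∈ balRel k A X M :=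
    Submodule.subset_span ⟨x, a, m, rfl⟩
  exact (Submodule.Quotient.eq _).2 this

lemma balMap_bt (f : M →ₗ[A] N) (x : X) (m : M) : balMap k A X f (bt k A x m) = bt k A x (f m) := by
  rfl

lemma bal_induction {p : balTensor k A X M → Prop} (h0 : p 0) (hb : ∀ x m, p (bt k A x m))
    (ha : ∀ x y, p x → p y → p (x + y)) (z : balTensor k A X M) : p z := by
  obtain ⟨w, rfl⟩ := (balRel k A X M).mkQ_surjective z
  induction w using TensorProduct.induction_on with
  | zero => rw [map_zero]; exact h0
  | tmul x y => exact hb x y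
  | add x y hx hy => rw [map_add]; exact ha _ _ hx hy

lemma balLift {Q : Type} [AddCommGroup Q] [Module k Q] (b : X →ₗ[k] M →ₗ[k] Q)
    (hb : ∀ x (a : A) m, b (MulOpposite.op a • x) m = b x (a • m)) :
    ∃ φ : balTensor k A X M →ₗ[k] Q, ∀ x m, φ (bt k A x m) = b x m := by
  refine ⟨(balRel k A X M).liftQ (TensorProduct.lift b) ?_, ?_⟩
  · rw [balRel, Submodule.span_le]
    rintro _ ⟨x, a, m, rfl⟩
    simp [hb]
  · intro x m
    exact ((balRel k A X M).liftQ_apply _ _).trans (TensorProduct.lift.tmul _ _)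
end

variable (I : TwoSidedIdeal A)
variable {M N : Type} 
  [AddCommGroup M] [Module A M] [Module k M] [IsScalarTower k A M]
  [AddCommGroup N] [Module A N] [Module k N] [IsScalarTower k A N]

lemma rI_smul_coe (r : k) (x : rIdeal A I) : ((r • x : rIdeal A I) : A) = r • (x : A) := rfl
lemma rI_op_coe (a : A) (x : rIdeal A I) :
    ((MulOpposite.op a • x : rIdeal A I) : A) = (x : A) * a := rfl

variable (k M) in
lemma bmul_exists : ∃ φ : balTensor k A (rIdeal A I) M →ₗ[k] M,
    ∀ x m, φ (bt k A x m) = (x : A) • m := by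
  refine balLift (LinearMap.mk₂ k (fun (x : rIdeal A I) (m : M) => (x : A) • m) ?_ ?_ ?_ ?_) ?_
  · intro x y m; rw [← add_smul]; rfl
  · intro c x m; rw [rI_smul_coe, smul_assoc]
  · intro x m n; rw [smul_add]
  · intro c x m; rw [smul_comm]
  · intro x a m
    simp [rI_op_coe, mul_smul]

variable (k M) in
noncomputable def bmul : balTensor k A (rIdeal A I) M →ₗ[k] M := (bmul_exists k I M).choose

lemma bmul_bt (x : rIdeal A I) (m : M) : bmul k I M (bt k A x m) = (x : A) • m :=
  (bmul_exists k I M).choose_spec x m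

lemma bmul_map (f : M →ₗ[A] N) (z : balTensor k A (rIdeal A I) M) :
    bmul k I N (balMap k A _ f z) = f (bmul k I M z) := by
  induction z using bal_induction with
  | h0 => simp
  | hb x m => rw [balMap_bt, bmul_bt, bmul_bt, map_smul]
  | ha x y hx hy => rw [map_add, map_add, map_add, map_add, hx, hy]

lemma bmul_free_inj (ι : Type) : Function.Injective (bmul k I (ι →₀ A)) := by
  let θ : (ι →₀ rIdeal A I) →+ balTensor k A (rIdeal A I) (ι →₀ A) :=
    Finsupp.liftAddHom fun i =>
      { toFun := fun x => bt k A x (Finsupp.single i (1 : A))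
        map_zero' := zero_bt _
        map_add' := fun x y => add_bt x y _ }
  have hθs : ∀ i x, θ (Finsupp.single i x) = bt k A x (Finsupp.single i (1 : A)) := by
    intro i x
    exact Finsupp.liftAddHom_apply_single _ _ _
  have hθ : ∀ z, ∃ y, θ y = z := by
    intro z
    induction z using bal_induction with
    | h0 => exact ⟨0, map_zero _⟩
    | hb x m =>
      induction m using Finsupp.induction_linear with
      | zero => exact ⟨0, by rw [map_zero, bt_zero]⟩
      | add f g hf hg =>
        obtain ⟨y, hy⟩ := hf
        obtain ⟨y', hy'⟩ := hg
        exact ⟨y + y', by rw [map_add, hy, hy', bt_add]⟩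
      | single i a =>
        refine ⟨Finsupp.single i (MulOpposite.op a • x), ?_⟩
        rw [hθs, bt_bal, Finsupp.smul_single, smul_eq_mul, mul_one]
    | ha x y hx hy =>
      obtain ⟨u, hu⟩ := hx
      obtain ⟨v, hv⟩ := hy
      exact ⟨u + v, by rw [map_add, hu, hv]⟩
  have hb : ∀ y i, bmul k I (ι →₀ A) (θ y) i = (y i : A) := by
    intro y i
    induction y using Finsupp.induction_linear with
    | zero => simp
    | add f g hf hg => simp [hf, hg]
    | single j x =>
      classical
      rw [hθs, bmul_bt, Finsupp.smul_single, smul_eq_mul, mul_one, Finsupp.single_apply,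
        Finsupp.single_apply]
      split_ifs <;> rfl
  rw [injective_iff_map_eq_zero]
  intro z hz
  obtain ⟨y, rfl⟩ := hθ z
  have : y = 0 := by
    ext i
    rw [← hb y i, hz]; rfl
  rw [this, map_zero]

lemma balMap_comp_apply {L : Type} [AddCommGroup L] [Module A L] [Module k L] [IsScalarTower k A L]
    (f : M →ₗ[A] N) (g : N →ₗ[A] L) (z : balTensor k A (rIdeal A I) M) :
    balMap k A _ g (balMap k A _ f z) = balMap k A _ (g ∘ₗ f) z := by
  induction z using bal_induction with
  | h0 => simp
  | hb x m => rfl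
  | ha x y hx hy => simp only [map_add, hx, hy]

lemma balMap_id_apply (z : balTensor k A (rIdeal A I) M) :
    balMap k A _ (LinearMap.id : M →ₗ[A] M) z = z := by
  induction z using bal_induction with
  | h0 => simp
  | hb x m => rfl
  | ha x y hx hy => simp only [map_add, hx, hy]

lemma bmul_proj_inj [Module.Projective A M] : Function.Injective (bmul k I M) := by
  obtain ⟨s, hs⟩ := (Module.projective_def' (R := A) (P := M)).1 inferInstance
  rw [injective_iff_map_eq_zero]
  intro z hz
  have h1 : balMap k A _ s z = 0 := by
    apply bmul_free_inj I
    rw [bmul_map, hz, map_zero, map_zero]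
  rw [← balMap_id_apply I z, ← hs, ← balMap_comp_apply, h1, map_zero]


lemma bal_inj_of_proj {σ : Type} [Module.Projective A M] (f : M →ₗ[A] (σ →₀ A)) (hf : Function.Injective f)
    (z : balTensor k A (rIdeal A I) M) (hz : balMap k A (rIdeal A I) f z = 0) : z = 0 := by
  apply bmul_proj_inj I
  rw [map_zero]
  apply hf
  rw [← bmul_map, hz, map_zero, map_zero]

lemma tor_of_pd (T : Type) [AddCommGroup T] [Module A T] [Module k T] [IsScalarTower k A T]
    (h : pdLeOne A T) : Subsingleton (Tor1 k A (rIdeal A I) T) := by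
  have hp : Module.Projective A (presKer A T) := by
    obtain ⟨P₀, P₁, _, _, i, p, hi, hp, hex⟩ := h
    obtain ⟨s, r, hrs⟩ := schanuel (Finsupp.linearCombination A (id : T → T)) cover_surj p hp
    have h1 : LinearMap.ker p = LinearMap.range i := LinearMap.exact_iff.1 hex
    have : Module.Projective A (LinearMap.ker p) := by
      rw [h1]
      exact Module.Projective.of_equiv (LinearEquiv.ofInjective i hi)
    exact Module.Projective.of_split s r hrs
  have key := bal_inj_of_proj (k := k) I (M := ↥(presKer A T)) (σ := T) (presKer A T).subtype
    (Submodule.subtype_injective _)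
  refine ⟨fun x y => ?_⟩
  apply Subtype.ext
  rw [key x.1 x.2, key y.1 y.2]

lemma extend_functional {k U V : Type} [Field k] [AddCommGroup U] [Module k U] [AddCommGroup V] [Module k V]
    (g : U →ₗ[k] V) (lam : U →ₗ[k] k) (h : ∀ u, g u = 0 → lam u = 0) :
    ∃ μ : V →ₗ[k] k, ∀ u, μ (g u) = lam u := by
  have h1 : lam ∈ (LinearMap.ker g).dualAnnihilator := by
    rw [Submodule.mem_dualAnnihilator]
    exact h
  rw [← LinearMap.range_dualMap_eq_dualAnnihilator_ker] at h1
  obtain ⟨μ, hμ⟩ := h1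
  exact ⟨μ, fun u => LinearMap.congr_fun hμ u⟩

lemma extend_functional' {k V : Type} [Field k] [AddCommGroup V] [Module k V]
    (U W : Submodule k V) (lam : U →ₗ[k] k) (h : ∀ z (hz : z ∈ U), z ∈ W → lam ⟨z, hz⟩ = 0) :
    ∃ μ : V →ₗ[k] k, (∀ w ∈ W, μ w = 0) ∧ ∀ u : U, μ u = lam u := by
  obtain ⟨μ, hμ⟩ := extend_functional (W.mkQ ∘ₗ U.subtype) lam (fun u hu =>
    h u.1 u.2 ((Submodule.Quotient.mk_eq_zero W).1 hu))
  refine ⟨μ ∘ₗ W.mkQ, fun w hw => ?_, hμ⟩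
  rw [LinearMap.comp_apply, Submodule.mkQ_apply, (Submodule.Quotient.mk_eq_zero W).2 hw, map_zero]

lemma EV_of_bal {σ : Type} (f : M →ₗ[A] (σ →₀ A))
    (htor : ∀ z : balTensor k A (rIdeal A I) M, balMap k A (rIdeal A I) f z = 0 → z = 0) :
    EV A M (DBar k A I) := by
  refine EV.of_extend (Finsupp.linearCombination A (id : M → M)) cover_surj ?_
  have hδ1 : ∀ κ, Finsupp.linearCombination A (id : M → M) (Finsupp.single κ 1) = κ := by
    intro κ; simp
  generalize Finsupp.linearCombination A (id : M → M) = δ at hδ1 ⊢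
  intro h
  let U : Submodule k (M →₀ A) := (LinearMap.ker δ).restrictScalars k
  let lam : U →ₗ[k] k :=
    { toFun := fun z => (h z).1 1
      map_add' := fun x y => by
        have := map_add h x y
        exact LinearMap.congr_fun (congrArg Subtype.val this) 1
      map_smul' := fun r x => by
        have h1 : h ((algebraMap k A r) • x) = (algebraMap k A r) • h x := map_smul h _ _
        have h2 : (algebraMap k A r) • x = r • x := algebraMap_smul A r x
        rw [h2] at h1
        have h3 := LinearMap.congr_fun (congrArg Subtype.val h1) 1
        refine h3.trans ?_
        change (h x).1 (1 * algebraMap k A r) = r • (h x).1 1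
        rw [one_mul, Algebra.algebraMap_eq_smul_one, map_smul] }
  have hlam : ∀ (z : LinearMap.ker δ) (b : A), (h z).1 b = (h (b • z)).1 1 := by
    intro z b
    rw [map_smul]
    change _ = (h z).1 (1 * b)
    rw [one_mul]
  let IK : Submodule k (M →₀ A) := Submodule.span k {p | ∃ x ∈ I, ∃ z ∈ U, p = x • z}
  let IP : Submodule k (M →₀ A) := Submodule.span k {p | ∃ x ∈ I, ∃ z, p = x • z}
  -- lam vanishes on IK
  have hIK : ∀ p ∈ IK, ∃ hp : p ∈ U, lam ⟨p, hp⟩ = 0 := by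
    intro p hp
    induction hp using Submodule.span_induction with
    | mem p hp =>
      obtain ⟨x, hx, z, hz, rfl⟩ := hp
      refine ⟨(LinearMap.ker δ).smul_mem x hz, ?_⟩
      have h1 := hlam ⟨z, hz⟩ x
      rw [(h ⟨z, hz⟩).2 x hx] at h1
      exact h1.symm
    | zero => exact ⟨U.zero_mem, lam.map_zero⟩
    | add p q _ _ hp hq =>
      obtain ⟨hp, hp'⟩ := hp
      obtain ⟨hq, hq'⟩ := hq
      refine ⟨U.add_mem hp hq, ?_⟩
      have := lam.map_add ⟨p, hp⟩ ⟨q, hq⟩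
      rw [hp', hq', add_zero] at this
      exact this
    | smul r p _ hp =>
      obtain ⟨hp, hp'⟩ := hp
      refine ⟨U.smul_mem r hp, ?_⟩
      have := lam.map_smul r ⟨p, hp⟩
      rw [hp', smul_zero] at this
      exact this
  -- the map Ψ
  have hmk : ∀ (x : rIdeal A I) z, δ z = 0 → IK.mkQ ((x : A) • z) = 0 := by
    intro x z hz
    rw [Submodule.mkQ_apply, Submodule.Quotient.mk_eq_zero]
    exact Submodule.subset_span ⟨x, x.2, z, hz, rfl⟩
  have hmk' : ∀ (x : rIdeal A I) z z', δ z = δ z' → IK.mkQ ((x : A) • z) = IK.mkQ ((x : A) • z') := by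
    intro x z z' hz
    rw [← sub_eq_zero, ← map_sub, ← smul_sub]
    apply hmk
    rw [map_sub, hz, sub_self]
  have hδk : ∀ (r : k) z, δ (r • z) = r • δ z := by
    intro r z
    rw [← algebraMap_smul A r z, map_smul, algebraMap_smul]
  obtain ⟨Ψ, hΨ⟩ := balLift (A := A) (LinearMap.mk₂ k
    (fun (x : rIdeal A I) (κ : M) => IK.mkQ ((x : A) • Finsupp.single κ (1 : A)))
    (by intro x y m; rw [← map_add, ← add_smul]; rfl)
    (by intro c x m; rw [← map_smul, rI_smul_coe, smul_assoc])
    (by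
      intro x m n
      rw [← map_add, ← smul_add]
      apply hmk'
      rw [map_add, hδ1, hδ1, hδ1])
    (by
      intro c x m
      rw [← map_smul, smul_comm c]
      apply hmk'
      rw [hδ1, hδk, hδ1]))
    (by
      intro x a m
      simp only [LinearMap.mk₂_apply]
      rw [rI_op_coe, mul_smul]
      apply hmk'
      rw [hδ1, map_smul, hδ1])
  have hΨδ : ∀ w, Ψ (balMap k A _ δ w) = IK.mkQ (bmul k I _ w) := by
    intro w
    induction w using bal_induction with
    | h0 => simp
    | hb x m =>
      rw [balMap_bt, hΨ, bmul_bt, LinearMap.mk₂_apply]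
      apply hmk'
      rw [hδ1]
    | ha x y hx hy => simp only [map_add, hx, hy]
  have hIP : ∀ p ∈ IP, ∃ w, bmul k I (M →₀ A) w = p := by
    intro p hp
    have : IP ≤ LinearMap.range (bmul k I (M →₀ A)) := by
      rw [Submodule.span_le]
      rintro _ ⟨x, hx, z, rfl⟩
      exact ⟨bt k A (⟨x, hx⟩ : rIdeal A I) z, bmul_bt I _ _⟩
    exact this hp
  have hcap : ∀ p ∈ U, p ∈ IP → p ∈ IK := by
    intro p hp hp'
    obtain ⟨w, rfl⟩ := hIP p hp'
    have h0 : balMap k A _ δ w = 0 := by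
      apply htor
      apply bmul_free_inj I
      rw [bmul_map, bmul_map, map_zero]
      have : δ (bmul k I _ w) = 0 := hp
      rw [this, map_zero]
    have h1 := hΨδ w
    rw [h0, map_zero] at h1
    rw [← Submodule.Quotient.mk_eq_zero]
    exact h1.symm
  -- extend lam
  obtain ⟨g0, hg0, hg0'⟩ := extend_functional' (V := (M →₀ A)) U IP lam
    (fun z hz hz' => (hIK z (hcap z hz hz')).2)
  refine ⟨(toDual g0).codRestrict (DBar k A I) ?_, ?_⟩
  · intro p a ha
    rw [toDual_apply]
    exact hg0 _ (Submodule.subset_span ⟨a, ha, p, rfl⟩)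
  · refine LinearMap.ext fun z => Subtype.ext (LinearMap.ext fun b => ?_)
    rw [hlam z b]
    exact hg0' (b • z : LinearMap.ker δ)

lemma ext2_of_tor (T : Type) [AddCommGroup T] [Module A T] [Module k T] [IsScalarTower k A T]
    (h : Subsingleton (Tor1 k A (rIdeal A I) T)) : Subsingleton (egrp A 2 T (DBar k A I)) := by
  rw [ext2_iff T _ (Finsupp.linearCombination A (id : T → T)) cover_surj]
  refine EV_of_bal (k := k) I (M := ↥(presKer A T)) (σ := T) (presKer A T).subtype ?_
  intro z hz
  exact congrArg Subtype.val (h.elim (⟨z, hz⟩ : Tor1 k A (rIdeal A I) T) 0)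
end

end

section

section
variable (k : Type) {A : Type} [Field k] [Ring A] [Algebra k A]

/-- Hom spaces as `k`-modules -/
def HM (_ : Type) {A : Type} [Ring A] (M X : Type) [AddCommGroup M] [Module A M]
    [AddCommGroup X] [Module A X] : Type := M →ₗ[A] X

section
variable (M X Y : Type) [AddCommGroup M] [Module A M] [AddCommGroup X] [Module A X]
  [AddCommGroup Y] [Module A Y]

noncomputable instance : AddCommGroup (HM k (A := A) M X) :=
  inferInstanceAs (AddCommGroup (M →ₗ[A] X))

noncomputable instance : Module k (HM k (A := A) M X) where
  smul r f :=
    { toFun := fun x => algebraMap k A r • f.toFun x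
      map_add' := fun x y => by rw [f.map_add', smul_add]
      map_smul' := fun a x => by
        rw [f.map_smul', RingHom.id_apply, ← mul_smul, ← mul_smul, Algebra.commutes] }
  one_smul f := by
    refine LinearMap.ext fun x => ?_
    change algebraMap k A 1 • f.toFun x = f.toFun x
    rw [map_one, one_smul]
  mul_smul r s f := by
    refine LinearMap.ext fun x => ?_
    change algebraMap k A (r * s) • f.toFun x = algebraMap k A r • algebraMap k A s • f.toFun x
    rw [map_mul, mul_smul]
  smul_zero r := by
    refine LinearMap.ext fun x => ?_
    change algebraMap k A r • (0 : X) = 0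
    rw [smul_zero]
  smul_add r f g := by
    refine LinearMap.ext fun x => ?_
    change algebraMap k A r • (f.toFun x + g.toFun x) = algebraMap k A r • f.toFun x + algebraMap k A r • g.toFun x
    rw [smul_add]
  add_smul r s f := by
    refine LinearMap.ext fun x => ?_
    change algebraMap k A (r + s) • f.toFun x = algebraMap k A r • f.toFun x + algebraMap k A s • f.toFun x
    rw [map_add, add_smul]
  zero_smul f := by
    refine LinearMap.ext fun x => ?_
    change algebraMap k A 0 • f.toFun x = 0
    rw [map_zero, zero_smul]

lemma HM_smul_apply (r : k) (f : HM k (A := A) M X) (x : M) :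
    (show M →ₗ[A] X from r • f) x = algebraMap k A r • (show M →ₗ[A] X from f) x := rfl

variable {M X Y}
/-- postcomposition -/
noncomputable def hpost (g : X →ₗ[A] Y) : HM k (A := A) M X →ₗ[k] HM k (A := A) M Y where
  toFun f := g ∘ₗ (show M →ₗ[A] X from f)
  map_add' f f' := by exact LinearMap.comp_add _ _ _
  map_smul' r f := by
    refine LinearMap.ext fun x => ?_
    exact map_smul g (algebraMap k A r) _

/-- precomposition -/
noncomputable def hpre (g : X →ₗ[A] Y) : HM k (A := A) Y M →ₗ[k] HM k (A := A) X M where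
  toFun f := (show Y →ₗ[A] M from f) ∘ₗ g
  map_add' f f' := by exact LinearMap.add_comp _ _ _
  map_smul' r f := rfl

variable (M X)
lemma HM_finite [Module.Finite k A] [Module.Finite A M] [Module.Finite A X] :
    Module.Finite k (HM k (A := A) M X) := by
  obtain ⟨n, e, he⟩ := Module.Finite.exists_fin' A M
  letI : Module k X := Module.compHom X (algebraMap k A)
  haveI : IsScalarTower k A X := IsScalarTower.of_algebraMap_smul fun r x => rfl
  haveI : Module.Finite k X := Module.Finite.trans A X
  let Φ : HM k (A := A) M X →ₗ[k] (Fin n → X) :=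
    { toFun := fun f i => (show M →ₗ[A] X from f) (e (Pi.single i 1))
      map_add' := fun f g => rfl
      map_smul' := fun r f => rfl }
  refine Module.Finite.of_injective Φ ?_
  rw [injective_iff_map_eq_zero]
  intro f hf
  have : (show M →ₗ[A] X from f) ∘ₗ e = 0 := by
    refine LinearMap.pi_ext' fun i => ?_
    refine LinearMap.ext_ring ?_
    exact congrFun hf i
  refine LinearMap.ext fun m => ?_
  obtain ⟨v, rfl⟩ := he m
  exact LinearMap.congr_fun this v

/-- dimension of Hom -/
noncomputable def hd (M X : Type) [AddCommGroup M] [Module A M] [AddCommGroup X] [Module A X] : ℕ :=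
  Module.finrank k (HM k (A := A) M X)
end

/-- killed by `I` -/
def Kld (I : TwoSidedIdeal A) (X : Type) [AddCommGroup X] [Module A X] : Prop :=
  ∀ a ∈ I, ∀ x : X, a • x = 0

/-- relatively projective for killed modules -/
def RP (I : TwoSidedIdeal A) (M : Type) [AddCommGroup M] [Module A M] : Prop :=
  ∀ (X Y : Type) [AddCommGroup X] [Module A X] [AddCommGroup Y] [Module A Y],
    Module.Finite A X → Kld I X → ∀ q : X →ₗ[A] Y, Function.Surjective q → ∀ f : M →ₗ[A] Y,
    ∃ g : M →ₗ[A] X, q ∘ₗ g = f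

variable {k}
variable {M X Y : Type} [AddCommGroup M] [Module A M] [AddCommGroup X] [Module A X]
  [AddCommGroup Y] [Module A Y] {I : TwoSidedIdeal A}

lemma Kld.sub (h : Kld I X) (N : Submodule A X) : Kld I N :=
  fun a ha x => Subtype.ext (h a ha x)

lemma Kld.surj (h : Kld I X) (q : X →ₗ[A] Y) (hq : Function.Surjective q) : Kld I Y := by
  intro a ha y
  obtain ⟨x, rfl⟩ := hq y
  rw [← map_smul, h a ha, map_zero]

lemma Kld.inj (h : Kld I Y) (q : X →ₗ[A] Y) (hq : Function.Injective q) : Kld I X := by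
  intro a ha x
  apply hq
  rw [map_smul, h a ha, map_zero]

lemma Kld.pi (h : Kld I X) (n : ℕ) : Kld I (Fin n → X) :=
  fun a ha x => funext fun i => h a ha (x i)

lemma hd_congr (e : X ≃ₗ[A] Y) : hd k (A := A) M X = hd k (A := A) M Y := by
  refine LinearEquiv.finrank_eq (LinearEquiv.ofBijective (hpost k (M := M) e.toLinearMap) ⟨?_, ?_⟩)
  · intro f g hfg
    refine LinearMap.ext fun x => e.injective ?_
    exact LinearMap.congr_fun hfg x
  · intro f
    refine ⟨e.symm.toLinearMap ∘ₗ (show M →ₗ[A] Y from f), ?_⟩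
    refine LinearMap.ext fun x => ?_
    exact e.apply_symm_apply _

lemma hd_subsingleton [Subsingleton X] : hd k (A := A) M X = 0 := by
  have : Subsingleton (HM k (A := A) M X) :=
    ⟨fun f g => LinearMap.ext fun x => Subsingleton.elim _ _⟩
  exact Module.finrank_zero_of_subsingleton

lemma hd_add [Module.Finite k A] [IsNoetherianRing A] [Module.Finite A M] [Module.Finite A X]
    (hM : RP I M) (hX : Kld I X) (N : Submodule A X) :
    hd k (A := A) M X = hd k (A := A) M N + hd k (A := A) M (X ⧸ N) := by
  have := HM_finite k M X (A := A)
  have h := LinearMap.finrank_range_add_finrank_ker (hpost k (M := M) N.mkQ)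
  have h1 : LinearMap.range (hpost k (M := M) N.mkQ) = ⊤ := by
    rw [LinearMap.range_eq_top]
    intro f
    exact hM X (X ⧸ N) inferInstance hX N.mkQ N.mkQ_surjective f
  have h2 : LinearMap.ker (hpost k (M := M) N.mkQ) = LinearMap.range (hpost k (M := M) N.subtype) := by
    ext f
    constructor
    · intro hf
      obtain ⟨g, hg⟩ := factor_inj N.subtype N.subtype_injective (show M →ₗ[A] X from f) (fun x => by
        have h3 : N.mkQ ((show M →ₗ[A] X from f) x) = 0 := LinearMap.congr_fun hf x
        exact ⟨⟨_, (Submodule.Quotient.mk_eq_zero N).1 h3⟩, rfl⟩)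
      exact ⟨g, hg⟩
    · rintro ⟨g, rfl⟩
      refine LinearMap.ext fun x => ?_
      exact (Submodule.Quotient.mk_eq_zero N).2 ((show M →ₗ[A] N from g) x).2
  rw [h1, h2, finrank_top, LinearMap.finrank_range_of_inj] at h
  · rw [hd, ← h, add_comm]; rfl
  · intro f g hfg
    refine LinearMap.ext fun x => Subtype.ext ?_
    exact LinearMap.congr_fun hfg x

end

section
variable (k : Type) {A : Type} [Field k] [Ring A] [Algebra k A]
variable {P N : Type} [AddCommGroup P] [Module A P] [AddCommGroup N] [Module A N]

/-- Euler form -/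
noncomputable def chi (e : P →ₗ[A] N) (X : Type) [AddCommGroup X] [Module A X] : ℤ :=
  (hd k (A := A) P X : ℤ) - (hd k (A := A) (LinearMap.ker e) X : ℤ)

variable (e : P →ₗ[A] N) {X : Type} [AddCommGroup X] [Module A X]
  [Module.Finite k A] [IsNoetherianRing A] [Module.Finite A P] [Module.Finite A X]

lemma chi_zero (hi : ∀ g : P →ₗ[A] X, g ∘ₗ (LinearMap.ker e).subtype = 0 → g = 0)
    (hs : ∀ f : LinearMap.ker e →ₗ[A] X, ∃ g : P →ₗ[A] X, g ∘ₗ (LinearMap.ker e).subtype = f) :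
    chi k e X = 0 := by
  have := LinearEquiv.finrank_eq (LinearEquiv.ofBijective
    (hpre k (M := X) (LinearMap.ker e).subtype) ⟨(injective_iff_map_eq_zero _).2 hi, hs⟩)
  rw [chi, hd, hd, this, sub_self]

lemma chi_pos (hi : ∃ g : P →ₗ[A] X, g ∘ₗ (LinearMap.ker e).subtype = 0 ∧ g ≠ 0)
    (hs : ∀ f : LinearMap.ker e →ₗ[A] X, ∃ g : P →ₗ[A] X, g ∘ₗ (LinearMap.ker e).subtype = f) :
    chi k e X ≠ 0 := by
  have := HM_finite k P X (A := A)
  have := HM_finite k (LinearMap.ker e) X (A := A)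
  intro h0
  have h1 : Module.finrank k (HM k (A := A) P X) = Module.finrank k (HM k (A := A) (LinearMap.ker e) X) := by
    rw [chi, hd, hd] at h0; omega
  obtain ⟨g, hg, hg'⟩ := hi
  have h2 := (LinearMap.injective_iff_surjective_of_finrank_eq_finrank h1
    (f := hpre k (M := X) (LinearMap.ker e).subtype)).2 hs
  exact hg' ((injective_iff_map_eq_zero _).1 h2 g hg)

lemma chi_neg (hi : ∀ g : P →ₗ[A] X, g ∘ₗ (LinearMap.ker e).subtype = 0 → g = 0)
    (hs : ∃ f : LinearMap.ker e →ₗ[A] X, ∀ g : P →ₗ[A] X, g ∘ₗ (LinearMap.ker e).subtype ≠ f) :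
    chi k e X ≠ 0 := by
  have := HM_finite k P X (A := A)
  have := HM_finite k (LinearMap.ker e) X (A := A)
  intro h0
  have h1 : Module.finrank k (HM k (A := A) P X) = Module.finrank k (HM k (A := A) (LinearMap.ker e) X) := by
    rw [chi, hd, hd] at h0; omega
  obtain ⟨f, hf⟩ := hs
  have h2 := (LinearMap.injective_iff_surjective_of_finrank_eq_finrank h1
    (f := hpre k (M := X) (LinearMap.ker e).subtype)).1 ((injective_iff_map_eq_zero _).2 hi)
  obtain ⟨g, hg⟩ := h2 f
  exact hf g hg

lemma chi_add {I : TwoSidedIdeal A} (hP : RP I P) (hK : RP I (LinearMap.ker e)) (hX : Kld I X)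
    (L : Submodule A X) : chi k e X = chi k e L + chi k e (X ⧸ L) := by
  rw [chi, chi, chi, hd_add hP hX L, hd_add hK hX L]
  push_cast
  ring
end

end

section

section
variable {A : Type} [Ring A] {M N : Type} [AddCommGroup M] [Module A M] [AddCommGroup N] [Module A N]

lemma indec_fitting [IsNoetherian A M] [IsArtinian A M] (h : isIndec A M) (e : Module.End A M) :
    Function.Bijective e ∨ IsNilpotent e := by
  obtain ⟨n, hn⟩ := Filter.eventually_atTop.1 (LinearMap.eventually_isCompl_ker_pow_range_pow e)
  have hc := hn (n + 1) (by omega)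
  rcases h.2 _ _ ⟨(Submodule.prodEquivOfIsCompl _ _ hc).symm⟩ with h1 | h1
  · left
    apply IsArtinian.bijective_of_injective_endomorphism
    rw [Submodule.subsingleton_iff_eq_bot, LinearMap.ker_eq_bot] at h1
    rw [pow_succ] at h1
    exact Function.Injective.of_comp h1
  · right
    rw [Submodule.subsingleton_iff_eq_bot, LinearMap.range_eq_bot] at h1
    exact ⟨_, h1⟩

lemma indec_local [IsNoetherian A M] [IsArtinian A M] (h : isIndec A M) :
    IsLocalRing (Module.End A M) := by
  have : Nontrivial M := h.1
  apply IsLocalRing.of_isUnit_or_isUnit_one_sub_self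
  intro e
  rcases indec_fitting h e with h1 | h1
  · exact Or.inl ((Module.End.isUnit_iff e).2 h1)
  · exact Or.inr h1.isUnit_one_sub

lemma lsum_comp {L ι : Type} [AddCommGroup L] [Module A L] [Fintype ι] (f : ι → N →ₗ[A] M) (s : L →ₗ[A] N) :
    (∑ i, f i) ∘ₗ s = ∑ i, f i ∘ₗ s := by
  ext x
  simp [LinearMap.sum_apply]

lemma bij_comp_inv (v : N →ₗ[A] M) (s : M →ₗ[A] N) (hb : Function.Bijective (v ∘ₗ s)) :
    ∃ t : M →ₗ[A] N, v ∘ₗ t = LinearMap.id := by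
  refine ⟨s ∘ₗ (LinearEquiv.ofBijective _ hb).symm.toLinearMap, ?_⟩
  ext x
  exact (LinearEquiv.ofBijective _ hb).apply_symm_apply x

lemma indec_split [IsNoetherian A N] [IsArtinian A N] (h : isIndec A N) [Nontrivial M]
    (v : N →ₗ[A] M) (s : M →ₗ[A] N) (hb : Function.Bijective (v ∘ₗ s)) :
    Nonempty (N ≃ₗ[A] M) := by
  obtain ⟨t, ht⟩ := bij_comp_inv v s hb
  have ht' : ∀ x, v (t x) = x := fun x => LinearMap.congr_fun ht x
  refine ⟨LinearEquiv.ofBijective v ⟨?_, fun x => ⟨t x, ht' x⟩⟩⟩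
  rcases indec_fitting h (t ∘ₗ v) with h1 | h1
  · exact Function.Injective.of_comp h1.1
  · exfalso
    obtain ⟨n, hn⟩ := h1
    have hp : ∀ (n : ℕ) (x : M), ((t ∘ₗ v : Module.End A N) ^ n) (t x) = t x := by
      intro n
      induction n with
      | zero => intro x; rfl
      | succ n ih =>
        intro x
        rw [pow_succ]
        change ((t ∘ₗ v : Module.End A N) ^ n) (t (v (t x))) = t x
        rw [ht', ih]
    obtain ⟨x, hx⟩ := exists_ne (0 : M)
    apply hx
    rw [← ht' x, ← hp n x, hn]
    simp
end

section
variable {k A : Type} [Field k] [Ring A] [Algebra k A]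
variable {T N : Type} [AddCommGroup T] [Module A T] [AddCommGroup N] [Module A N]

variable (k T) in
/-- the radical of `Hom(T, N)` -/
noncomputable def radH [IsNoetherian A N] [IsArtinian A N] (h : isIndec A N) :
    Submodule k (HM k (A := A) T N) where
  carrier := {f | ∀ s : N →ₗ[A] T, ¬ Function.Bijective ((show T →ₗ[A] N from f) ∘ₗ s)}
  add_mem' := by
    intro f g hf hg s hs
    have := indec_local h
    rcases IsLocalRing.isUnit_or_isUnit_of_isUnit_add (R := Module.End A N)
      (a := (show T →ₗ[A] N from f) ∘ₗ s) (b := (show T →ₗ[A] N from g) ∘ₗ s)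
      ((Module.End.isUnit_iff _).2 hs) with h1 | h1
    · exact hf s ((Module.End.isUnit_iff _).1 h1)
    · exact hg s ((Module.End.isUnit_iff _).1 h1)
  zero_mem' := by
    intro s hs
    have := h.1
    obtain ⟨x, hx⟩ := exists_ne (0 : N)
    obtain ⟨y, hy⟩ := hs.2 x
    exact hx hy.symm
  smul_mem' := by
    intro r f hf s hs
    apply hf (show N →ₗ[A] T from (r • (show HM k (A := A) N T from s)))
    convert hs using 1
    funext x
    exact map_smul (show T →ₗ[A] N from f) (algebraMap k A r) (s x)

lemma rad_cover [Module.Finite k A] [Module.Finite A T] [Module.Finite A N]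
    [IsNoetherian A N] [IsArtinian A N] (h : isIndec A N) :
    ∃ (n : ℕ) (φ : (Fin n → T) →ₗ[A] N), (∀ s : N →ₗ[A] (Fin n → T), φ ∘ₗ s ≠ LinearMap.id) ∧
      ∀ v : T →ₗ[A] N, (∀ s : N →ₗ[A] T, ¬ Function.Bijective (v ∘ₗ s)) →
        ∃ w : T →ₗ[A] (Fin n → T), φ ∘ₗ w = v := by
  have := HM_finite k T N (A := A)
  let b := Module.finBasis k (radH k T h)
  let f : ∀ i, T →ₗ[A] N := fun i => (b i).1
  refine ⟨_, ∑ i, f i ∘ₗ LinearMap.proj i, ?_, ?_⟩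
  · intro s hs
    have := indec_local h
    rw [lsum_comp] at hs
    have h1 : IsUnit (∑ i, ((f i ∘ₗ LinearMap.proj i) ∘ₗ s : Module.End A N)) := by
      rw [hs]; exact isUnit_one
    obtain ⟨i, _, hi⟩ := IsLocalRing.exists_of_isUnit_sum h1
    exact (b i).2 (LinearMap.proj i ∘ₗ s) ((Module.End.isUnit_iff _).1 hi)
  · intro v hv
    let v' : radH k T h := ⟨v, hv⟩
    refine ⟨LinearMap.pi fun i => (show T →ₗ[A] T from b.repr v' i • (show HM k (A := A) T T from LinearMap.id)), ?_⟩
    have h1 := b.sum_repr v'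
    have h2 := congrArg (fun z : radH k T h => (show T →ₗ[A] N from z.1)) h1
    refine Eq.trans ?_ h2
    have h3 : ((∑ i, b.repr v' i • b i : radH k T h) : HM k (A := A) T N)
        = ∑ i, b.repr v' i • (b i).1 := by
      rw [Submodule.coe_sum]; rfl
    change _ = (show T →ₗ[A] N from ((∑ i, b.repr v' i • b i : radH k T h) : HM k (A := A) T N))
    rw [h3, lsum_comp]
    change (∑ i, (show HM k (A := A) T N from _)) = _
    refine Finset.sum_congr rfl fun i _ => ?_
    refine LinearMap.ext fun x => ?_
    exact map_smul (f i) (algebraMap k A (b.repr v' i)) x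
end

section
variable {A : Type} [Ring A] (I : TwoSidedIdeal A)

/-- `A/I` as a left module -/
abbrev Bq : Type := A ⧸ (I.asIdeal : Submodule A A)

variable {I}
variable {X : Type} [AddCommGroup X] [Module A X]

lemma bspan (hX : Kld I X) (x : X) : ∃ g : Bq I →ₗ[A] X, ∀ a : A, g (Submodule.Quotient.mk a) = a • x := by
  refine ⟨Submodule.liftQ _ (LinearMap.toSpanSingleton A X x) ?_, fun a => ?_⟩
  · intro a ha
    rw [LinearMap.mem_ker, LinearMap.toSpanSingleton_apply]
    exact hX a (by simpa using ha) x
  · rfl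

lemma Kld_Bq : Kld I (Bq I) := by
  intro a ha x
  obtain ⟨b, rfl⟩ := Submodule.Quotient.mk_surjective _ x
  rw [← Submodule.Quotient.mk_smul, Submodule.Quotient.mk_eq_zero]
  simpa using I.mul_mem_right a b ha

lemma RP_Bq (n : ℕ) : RP I (Fin n → Bq I) := by
  intro X Y _ _ _ _ _ hX q hq f
  choose x hx using fun i => hq (f (Pi.single i (Submodule.Quotient.mk 1)))
  choose g hg using fun i => bspan hX (x i)
  refine ⟨∑ i, g i ∘ₗ LinearMap.proj i, ?_⟩
  refine LinearMap.pi_ext' fun i => ?_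
  refine LinearMap.ext fun b => ?_
  obtain ⟨a, rfl⟩ := Submodule.Quotient.mk_surjective _ b
  have h1 : (∑ i, g i ∘ₗ LinearMap.proj i : (Fin n → Bq I) →ₗ[A] X) (Pi.single i (Submodule.Quotient.mk a)) = a • x i := by
    rw [LinearMap.sum_apply, Finset.sum_eq_single i]
    · rw [LinearMap.comp_apply, LinearMap.proj_apply, Pi.single_eq_same]
      exact hg i a
    · intro j _ hj
      simp [Pi.single_eq_of_ne hj]
    · simp
  change q ((∑ i, g i ∘ₗ LinearMap.proj i : (Fin n → Bq I) →ₗ[A] X) (Pi.single i (Submodule.Quotient.mk a))) = f (Pi.single i (Submodule.Quotient.mk a))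
  rw [h1, map_smul, hx, ← map_smul, ← Pi.single_smul, ← Submodule.Quotient.mk_smul, smul_eq_mul, mul_one]

lemma Bq_cover [Module.Finite A X] (hX : Kld I X) :
    ∃ (n : ℕ) (e : (Fin n → Bq I) →ₗ[A] X), Function.Surjective e := by
  obtain ⟨n, p, hp⟩ := Module.Finite.exists_fin' A X
  choose g hg using fun i => bspan hX (p (Pi.single i 1))
  refine ⟨n, ∑ i, g i ∘ₗ LinearMap.proj i, ?_⟩
  intro x
  obtain ⟨v, rfl⟩ := hp x
  refine ⟨fun i => Submodule.Quotient.mk (v i), ?_⟩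
  rw [LinearMap.sum_apply]
  have : v = ∑ i, v i • Pi.single i (1 : A) := by
    simp [← Pi.single_smul, Finset.univ_sum_single]
  conv_rhs => rw [this, map_sum]
  refine Finset.sum_congr rfl fun i _ => ?_
  rw [map_smul]
  exact hg i (v i)
end

section
variable {A : Type} [Ring A]
variable {T : Type} [AddCommGroup T] [Module A T] [Module.Finite A T] {I : TwoSidedIdeal A}
variable {P N : Type} [AddCommGroup P] [Module A P] [AddCommGroup N] [Module A N]

lemma embed_fac (k : Type) [Field k] [Algebra k A] [Module.Finite k A] (hI : ∀ a : A, a ∈ I ↔ ∀ t : T, a • t = 0) (X : Type) [AddCommGroup X] [Module A X]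
    [Module.Finite A X] (hX : Kld I X) :
    ∃ (E : Type) (_ : AddCommGroup E) (_ : Module A E) (j : X →ₗ[A] E),
      Function.Injective j ∧ facP A T E ∧ Module.Finite A E ∧ Kld I E := by
  letI : Module k X := Module.compHom X (algebraMap k A)
  haveI : IsScalarTower k A X := IsScalarTower.of_algebraMap_smul fun r x => rfl
  haveI : Module.Finite k X := Module.Finite.trans A X
  letI : Module k T := Module.compHom T (algebraMap k A)
  haveI : IsScalarTower k A T := IsScalarTower.of_algebraMap_smul fun r x => rfl
  obtain ⟨n, j, hj⟩ := embed_DB (k := k) I hX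
  obtain ⟨h1, h2⟩ := DB_facP k T I hI
  refine ⟨_, _, _, j, hj, facP_pi h2 h1 n, inferInstance, ?_⟩
  apply Kld.pi
  intro a ha x
  apply Subtype.ext
  ext b
  exact x.2 (b * a) (I.mul_mem_left b a ha)

lemma RP_ker (k : Type) [Field k] [Algebra k A] [Module.Finite k A] (hI : ∀ a : A, a ∈ I ↔ ∀ t : T, a • t = 0)
    (hN : ∀ (M : Type) [AddCommGroup M] [Module A M], facP A T M → EV A N M)
    (e : P →ₗ[A] N) (he : Function.Surjective e) (hP : RP I P) : RP I (LinearMap.ker e) := by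
  intro X Y _ _ _ _ hfX hX q hq f
  obtain ⟨E, _, _, j, hj, hfE, hE, hEI⟩ := embed_fac k hI X hX
  let Z : Submodule A E := (LinearMap.ker q).map j
  obtain ⟨y, hy⟩ := factor_surj q hq (Z.mkQ ∘ₗ j) (by
    intro x hx
    exact (Submodule.Quotient.mk_eq_zero Z).2 ⟨x, hx, rfl⟩)
  obtain ⟨g, hg⟩ := (hN (E ⧸ Z) (hfE.surj Z.mkQ Z.mkQ_surjective)).extend e he (y ∘ₗ f)
  obtain ⟨g', hg'⟩ := hP E (E ⧸ Z) hE hEI Z.mkQ Z.mkQ_surjective g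
  have h1 : ∀ x : LinearMap.ker e, ∃ u, j u = g' x ∧ q u = f x := by
    intro x
    obtain ⟨u, hu⟩ := hq (f x)
    have h2 : Z.mkQ (g' x) = Z.mkQ (j u) := by
      have a1 := LinearMap.congr_fun hg' (x : P)
      have a2 := LinearMap.congr_fun hg x
      have a3 := LinearMap.congr_fun hy u
      simp only [LinearMap.comp_apply] at a1 a2 a3
      rw [a1, ← a3, hu]
      exact a2
    have h3 : g' x - j u ∈ Z := by
      rw [← Submodule.Quotient.mk_eq_zero, ← Submodule.mkQ_apply, map_sub, h2, sub_self]
    obtain ⟨z, hz, hz'⟩ := h3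
    refine ⟨z + u, by rw [map_add, hz', sub_add_cancel], ?_⟩
    rw [map_add, hu, LinearMap.mem_ker.1 hz, zero_add]
  obtain ⟨g'', hg''⟩ := factor_inj j hj (g' ∘ₗ (LinearMap.ker e).subtype) (fun x => by
    obtain ⟨u, hu, _⟩ := h1 x
    exact ⟨u, hu⟩)
  refine ⟨g'', LinearMap.ext fun x => ?_⟩
  obtain ⟨u, hu, hu'⟩ := h1 x
  have : g'' x = u := hj ((LinearMap.congr_fun hg'' x).trans hu.symm)
  rw [LinearMap.comp_apply, this, hu']
end

end

section

section
variable {A : Type} [Ring A] {T M N : Type} [AddCommGroup T] [Module A T] [AddCommGroup M] [Module A M]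
  [AddCommGroup N] [Module A N]

lemma facP_self : facP A T T :=
  ⟨1, LinearMap.proj 0, fun t => ⟨fun _ => t, rfl⟩⟩

lemma facP_prod (h : facP A T M) (h' : facP A T N) : facP A T (M × N) := by
  obtain ⟨n, f, hf⟩ := h
  obtain ⟨m, g, hg⟩ := h'
  let E : (Fin (n + m) → T) ≃ₗ[A] ((Fin n → T) × (Fin m → T)) :=
    (LinearEquiv.funCongrLeft A T finSumFinEquiv).trans (LinearEquiv.sumArrowLequivProdArrow _ _ A T)
  exact ⟨n + m, (f.prodMap g) ∘ₗ E.toLinearMap, (Function.Surjective.prodMap hf hg).comp E.surjective⟩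

lemma facP_sup {L : Submodule A M} (h : facP A T L) (f : T →ₗ[A] M) :
    facP A T (L ⊔ LinearMap.range f : Submodule A M) := by
  refine (facP_prod h facP_self).surj
    ((L.subtype.coprod f).codRestrict (L ⊔ LinearMap.range f) ?_) ?_
  · rintro ⟨x, t⟩
    exact Submodule.add_mem_sup x.2 ⟨t, rfl⟩
  · rintro ⟨x, hx⟩
    obtain ⟨l, hl, _, ⟨t, rfl⟩, rfl⟩ := Submodule.mem_sup.1 hx
    exact ⟨(⟨l, hl⟩, t), rfl⟩

lemma EV.lift_mk {L : Submodule A M} (h : EV A N L) (f : N →ₗ[A] M ⧸ L) :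
    ∃ g : N →ₗ[A] M, L.mkQ ∘ₗ g = f :=
  h M (M ⧸ L) L.subtype L.mkQ L.subtype_injective L.mkQ_surjective (by simp) f

end

section
variable {A : Type} [Ring A] [IsNoetherianRing A] [IsArtinianRing A]
variable {T : Type} [AddCommGroup T] [Module A T] [Module.Finite A T] {I : TwoSidedIdeal A}
variable {N : Type} [AddCommGroup N] [Module A N]

lemma key (k : Type) [Field k] [Algebra k A] [Module.Finite k A]
    (hI : ∀ a : A, a ∈ I ↔ ∀ t : T, a • t = 0)
    (hrig : ∀ (M : Type) [AddCommGroup M] [Module A M], facP A T M → EV A T M)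
    (sN : N →ₗ[A] T) (rN : T →ₗ[A] N) (hN : rN ∘ₗ sN = LinearMap.id) (hind : isIndec A N) :
    ∃ (X : Type) (_ : AddCommGroup X) (_ : Module A X), Module.Finite A X ∧ Kld I X ∧
      (∀ (P : Type) [AddCommGroup P] [Module A P] [Module.Finite A P] (e : P →ₗ[A] N),
        RP I P → Function.Surjective e → chi k e X ≠ 0) ∧
      (∀ (P N' : Type) [AddCommGroup P] [Module A P] [Module.Finite A P] [AddCommGroup N'] [Module A N']
        (e : P →ₗ[A] N') (s' : N' →ₗ[A] T) (r' : T →ₗ[A] N'), r' ∘ₗ s' = LinearMap.id → isIndec A N' →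
        ¬ Nonempty (N' ≃ₗ[A] N) →
        RP I P → Function.Surjective e → chi k e X = 0) := by
  have hNs : ∀ x, rN (sN x) = x := fun x => LinearMap.congr_fun hN x
  have hTk : Kld I T := fun a ha => (hI a).1 ha
  have hNk : Kld I N := hTk.surj rN fun x => ⟨_, hNs x⟩
  have : Module.Finite A N := Module.Finite.of_surjective rN fun x => ⟨_, hNs x⟩
  have := hind.1
  have hret : ∀ {N' : Type} [AddCommGroup N'] [Module A N'] (s' : N' →ₗ[A] T) (r' : T →ₗ[A] N'),
      r' ∘ₗ s' = LinearMap.id → ∀ (M : Type) [AddCommGroup M] [Module A M], facP A T M → EV A N' M :=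
    fun s' r' h M _ _ hM => (hrig M hM).retract s' r' h
  obtain ⟨n, φ, hφs, hφr⟩ := rad_cover (k := k) (T := T) hind
  have hT' : facP A T (Fin n → T) := ⟨n, LinearMap.id, Function.surjective_id⟩
  -- maps from other indecomposables factor
  have hfac : ∀ {N' : Type} [AddCommGroup N'] [Module A N'] (s' : N' →ₗ[A] T) (r' : T →ₗ[A] N'),
      r' ∘ₗ s' = LinearMap.id → isIndec A N' → ¬ Nonempty (N' ≃ₗ[A] N) →
      ∀ v : N' →ₗ[A] N, ∃ w : N' →ₗ[A] (Fin n → T), φ ∘ₗ w = v := by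
    intro N' _ _ s' r' h hi' hn v
    have : Module.Finite A N' := Module.Finite.of_surjective r' fun x => ⟨_, LinearMap.congr_fun h x⟩
    obtain ⟨w, hw⟩ := hφr (v ∘ₗ r') (by
      intro s hs
      exact hn (indec_split hi' v (r' ∘ₗ s) hs))
    refine ⟨w ∘ₗ s', ?_⟩
    rw [← LinearMap.comp_assoc, hw, LinearMap.comp_assoc, h, LinearMap.comp_id]
  by_cases hφ : Function.Surjective φ
  · -- case B
    obtain ⟨L, ⟨hLφ, hLf⟩, hLmax⟩ := WellFounded.has_min (wellFounded_gt (α := Submodule A (Fin n → T)))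
      {L | L ≤ LinearMap.ker φ ∧ facP A T L} ⟨⊥, bot_le, ⟨0, 0, fun x => ⟨0, Subsingleton.elim _ _⟩⟩⟩
    let φb : ((Fin n → T) ⧸ L) →ₗ[A] N := L.liftQ φ hLφ
    have hφb : ∀ x, φb (L.mkQ x) = φ x := fun x => rfl
    have hT0 : ∀ f : T →ₗ[A] LinearMap.ker φb, f = 0 := by
      intro f
      obtain ⟨f', hf'⟩ := EV.lift_mk (hrig L hLf) ((LinearMap.ker φb).subtype ∘ₗ f)
      have hf1 : ∀ t, L.mkQ (f' t) = f t := fun t => LinearMap.congr_fun hf' t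
      have h1 : ¬ (L < L ⊔ LinearMap.range f') := by
        apply hLmax
        refine ⟨sup_le hLφ ?_, facP_sup hLf f'⟩
        rintro _ ⟨t, rfl⟩
        rw [LinearMap.mem_ker, ← hφb, hf1]
        exact (f t).2
      have h2 : LinearMap.range f' ≤ L := by
        by_contra h3
        exact h1 (left_lt_sup.2 h3)
      refine LinearMap.ext fun t => Subtype.ext ?_
      rw [← hf1]
      exact (Submodule.Quotient.mk_eq_zero L).2 (h2 ⟨t, rfl⟩)
    have hN0 : ∀ {N' : Type} [AddCommGroup N'] [Module A N'] (s' : N' →ₗ[A] T) (r' : T →ₗ[A] N'),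
      r' ∘ₗ s' = LinearMap.id → ∀ (P : Type) [AddCommGroup P] [Module A P] (e : P →ₗ[A] N'),
        Function.Surjective e → ∀ g : P →ₗ[A] LinearMap.ker φb,
        g ∘ₗ (LinearMap.ker e).subtype = 0 → g = 0 := by
      intro N' _ _ s' r' h P _ _ e he g hg
      obtain ⟨g', rfl⟩ := factor_surj e he g (fun x hx => LinearMap.congr_fun hg ⟨x, hx⟩)
      have h1 := hT0 (g' ∘ₗ r')
      have h2 : g' = 0 := by
        have : (g' ∘ₗ r') ∘ₗ s' = g' := by
          rw [LinearMap.comp_assoc, h, LinearMap.comp_id]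
        rw [← this, h1, LinearMap.zero_comp]
      rw [h2, LinearMap.zero_comp]
    have hT'k : Kld I (Fin n → T) := hTk.pi n
    refine ⟨LinearMap.ker φb, inferInstance, inferInstance, inferInstance,
      (hT'k.surj L.mkQ L.mkQ_surjective).sub _, ?_, ?_⟩
    · intro P _ _ _ e hP he
      refine chi_neg k e (hN0 sN rN hN P e he) ?_
      obtain ⟨u, hu⟩ := hP _ _ inferInstance hT'k φ hφ e
      have hu' : ∀ x, φ (u x) = e x := fun x => LinearMap.congr_fun hu x
      refine ⟨((L.mkQ ∘ₗ u) ∘ₗ (LinearMap.ker e).subtype).codRestrict (LinearMap.ker φb) ?_, ?_⟩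
      · intro x
        rw [LinearMap.mem_ker]
        exact (hu' x).trans x.2
      · intro g hg
        obtain ⟨t, ht⟩ := factor_surj e he (L.mkQ ∘ₗ u - (LinearMap.ker φb).subtype ∘ₗ g) (by
          intro x hx
          have := congrArg Subtype.val (LinearMap.congr_fun hg ⟨x, hx⟩)
          rw [LinearMap.sub_apply, sub_eq_zero]
          exact this.symm)
        obtain ⟨t', ht'⟩ := EV.lift_mk (hret sN rN hN L hLf) t
        apply hφs t'
        refine LinearMap.ext fun y => ?_
        obtain ⟨x, rfl⟩ := he y
        have h1 : L.mkQ (t' (e x)) = L.mkQ (u x) - g x :=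
          (LinearMap.congr_fun ht' (e x)).trans (LinearMap.congr_fun ht x)
        have h2 : φb (g x) = 0 := (g x).2
        rw [LinearMap.comp_apply, ← hφb, h1, map_sub, h2, sub_zero, hφb, hu']
        rfl
    · intro P N' _ _ _ _ _ e s' r' h hi' hn hP he
      refine chi_zero k e (hN0 s' r' h P e he) ?_
      intro f
      obtain ⟨h', hh'⟩ := RP_ker k hI (hret s' r' h) e he hP _ _ inferInstance hT'k L.mkQ L.mkQ_surjective
        ((LinearMap.ker φb).subtype ∘ₗ f)
      have hh1 : ∀ x, L.mkQ (h' x) = f x := fun x => LinearMap.congr_fun hh' x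
      obtain ⟨u, hu⟩ := (hret s' r' h _ hT').extend e he h'
      have hu1 : ∀ x : LinearMap.ker e, u x = h' x := fun x => LinearMap.congr_fun hu x
      obtain ⟨v, hv⟩ := factor_surj e he (φ ∘ₗ u) (by
        intro x hx
        rw [LinearMap.comp_apply, hu1 ⟨x, hx⟩, ← hφb, hh1]
        exact (f _).2)
      obtain ⟨w, hw⟩ := hfac s' r' h hi' hn v
      refine ⟨(L.mkQ ∘ₗ (u - w ∘ₗ e)).codRestrict (LinearMap.ker φb) ?_, ?_⟩
      · intro x
        rw [LinearMap.mem_ker, LinearMap.comp_apply, hφb, LinearMap.sub_apply, map_sub, sub_eq_zero]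
        have h1 := LinearMap.congr_fun hv x
        have h2 := LinearMap.congr_fun hw (e x)
        exact h1.symm.trans h2.symm
      · refine LinearMap.ext fun x => Subtype.ext ?_
        rw [← hh1]
        change L.mkQ (u x - w (e x)) = _
        rw [LinearMap.mem_ker.1 x.2, map_zero, sub_zero, hu1]
  · -- case A
    have hNf : facP A T N := facP_self.surj rN fun x => ⟨_, hNs x⟩
    have hXf : facP A T (N ⧸ LinearMap.range φ) := hNf.surj _ (Submodule.mkQ_surjective _)
    refine ⟨N ⧸ LinearMap.range φ, inferInstance, inferInstance, inferInstance,
      hNk.surj _ (Submodule.mkQ_surjective _), ?_, ?_⟩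
    · intro P _ _ _ e hP he
      refine chi_pos k e ⟨(LinearMap.range φ).mkQ ∘ₗ e, ?_, ?_⟩ ((hret sN rN hN _ hXf).extend e he)
      · refine LinearMap.ext fun x => ?_
        change (LinearMap.range φ).mkQ (e x) = 0
        rw [LinearMap.mem_ker.1 x.2, map_zero]
      · intro h0
        apply hφ
        intro y
        obtain ⟨x, rfl⟩ := he y
        exact (Submodule.Quotient.mk_eq_zero (LinearMap.range φ)).1 (LinearMap.congr_fun h0 x)
    · intro P N' _ _ _ _ _ e s' r' h hi' hn hP he
      refine chi_zero k e ?_ ((hret s' r' h _ hXf).extend e he)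
      intro g hg
      obtain ⟨g', rfl⟩ := factor_surj e he g (fun x hx => LinearMap.congr_fun hg ⟨x, hx⟩)
      obtain ⟨v, hv⟩ := EV.lift_mk (hret s' r' h (LinearMap.range φ)
        ⟨n, φ.rangeRestrict, φ.surjective_rangeRestrict⟩) g'
      obtain ⟨w, hw⟩ := hfac s' r' h hi' hn v
      have : g' = 0 := by
        rw [← hv, ← hw]
        refine LinearMap.ext fun x => ?_
        exact (Submodule.Quotient.mk_eq_zero (LinearMap.range φ)).2 ⟨w x, rfl⟩
      rw [this, LinearMap.zero_comp]
end

end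

section

section
variable (A : Type) [Ring A]

/-- classes of simple modules -/
abbrev Sc : Type 1 := Quotient (isoSetoid A (fun N => IsSimpleModule A ↥N))

/-- classes of indecomposable summands -/
abbrev Ind (M : Type) [AddCommGroup M] [Module A M] : Type 1 :=
  Quotient (isoSetoid A (fun N => isIndec A ↥N ∧
    ∃ (s : ↥N →ₗ[A] M) (r : M →ₗ[A] ↥N), r.comp s = LinearMap.id))

variable {A}

lemma Sc_out (S : Type) [AddCommGroup S] [Module A S] (hS : IsSimpleModule A S) :
    Nonempty ((Quotient.mk (isoSetoid A (fun N => IsSimpleModule A ↥N))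
      ⟨ModuleCat.of A S, hS⟩ : Sc A).out.1 ≃ₗ[A] S) :=
  Quotient.mk_out (s := isoSetoid A (fun N => IsSimpleModule A ↥N)) ⟨ModuleCat.of A S, hS⟩

lemma Sc_eq (s : Sc A) (S : Type) [AddCommGroup S] [Module A S] (hS : IsSimpleModule A S)
    (h : Nonempty (s.out.1 ≃ₗ[A] S)) :
    s = Quotient.mk (isoSetoid A (fun N => IsSimpleModule A ↥N)) ⟨ModuleCat.of A S, hS⟩ := by
  rw [← Quotient.out_eq s]
  exact Quotient.sound h

lemma Sc_finite_aux {X : Type} [AddCommGroup X] [Module A X] (h : IsFiniteLength A X) :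
    {s : Sc A | ∃ f : X →ₗ[A] s.out.1, f ≠ 0}.Finite := by
  induction h with
  | of_subsingleton =>
    refine Set.Finite.subset Set.finite_empty ?_
    rintro s ⟨f, hf⟩
    exact hf (LinearMap.ext fun x => by rw [Subsingleton.elim x 0, map_zero, map_zero])
  | @of_simple_quotient M _ _ N hq hN ih =>
    refine (ih.insert (Quotient.mk (isoSetoid A (fun N => IsSimpleModule A ↥N))
      ⟨ModuleCat.of A (M ⧸ N), hq⟩)).subset ?_
    rintro s ⟨f, hf⟩
    have := s.out.2
    by_cases h : f ∘ₗ N.subtype = 0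
    · left
      have hle : N ≤ LinearMap.ker f := fun x hx => LinearMap.congr_fun h ⟨x, hx⟩
      have h1 : N.liftQ f hle ≠ 0 := by
        intro h0
        apply hf
        rw [← N.liftQ_mkQ f hle, h0, LinearMap.zero_comp]
      exact Sc_eq s _ hq ⟨(LinearEquiv.ofBijective _ (LinearMap.bijective_of_ne_zero h1)).symm⟩
    · right
      exact ⟨_, h⟩

lemma Sc_finite [IsNoetherianRing A] [IsArtinianRing A] : Finite (Sc A) := by
  have h := Sc_finite_aux (A := A) (X := A) (isFiniteLength_iff_isNoetherian_isArtinian.2 ⟨inferInstance, inferInstance⟩)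
  rw [← Set.finite_univ_iff]
  refine h.subset fun s _ => ?_
  have := s.out.2
  have := IsSimpleModule.nontrivial A s.out.1
  obtain ⟨x, hx⟩ := exists_ne (0 : s.out.1)
  refine ⟨LinearMap.toSpanSingleton A _ x, fun h0 => hx ?_⟩
  have := LinearMap.congr_fun h0 1
  simpa using this

lemma same_top {P S S' : Type} [AddCommGroup P] [Module A P] [AddCommGroup S] [Module A S]
    [AddCommGroup S'] [Module A S'] [IsNoetherian A P] [IsArtinian A P] [Module.Projective A P]
    (hP : isIndec A P) [IsSimpleModule A S] [IsSimpleModule A S'] (f : P →ₗ[A] S) (g : P →ₗ[A] S')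
    (hf : f ≠ 0) (hg : g ≠ 0) : Nonempty (S ≃ₗ[A] S') := by
  have hfs := LinearMap.surjective_of_ne_zero hf
  by_cases h : g ∘ₗ (LinearMap.ker f).subtype = 0
  · obtain ⟨g', rfl⟩ := factor_surj f hfs g (fun x hx => LinearMap.congr_fun h ⟨x, hx⟩)
    have : g' ≠ 0 := by
      rintro rfl
      exact hg (LinearMap.zero_comp _)
    exact ⟨LinearEquiv.ofBijective _ (LinearMap.bijective_of_ne_zero this)⟩
  · exfalso
    obtain ⟨e, he⟩ := Module.projective_lifting_property _ g (LinearMap.surjective_of_ne_zero h)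
    have he' : ∀ x, g (e x : P) = g x := fun x => LinearMap.congr_fun he x
    rcases indec_fitting hP ((LinearMap.ker f).subtype ∘ₗ e) with h1 | ⟨n, h1⟩
    · apply hf
      refine LinearMap.ext fun x => ?_
      obtain ⟨y, rfl⟩ := h1.2 x
      exact (e y).2
    · apply hg
      have hp : ∀ (n : ℕ) (x : P), g ((((LinearMap.ker f).subtype ∘ₗ e : Module.End A P) ^ n) x) = g x := by
        intro n
        induction n with
        | zero => intro x; rfl
        | succ n ih =>
          intro x
          rw [pow_succ]
          change g ((((LinearMap.ker f).subtype ∘ₗ e : Module.End A P) ^ n) (e x : P)) = g x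
          rw [ih, he']
      refine LinearMap.ext fun x => ?_
      rw [← hp n x, h1]
      simp

lemma exists_indec {M S : Type} [AddCommGroup M] [Module A M] [AddCommGroup S] [Module A S]
    [IsArtinian A M] (g : M →ₗ[A] S) (hg : g ≠ 0) :
    ∃ N : Submodule A M, isIndec A N ∧ (∃ r : M →ₗ[A] N, r ∘ₗ N.subtype = LinearMap.id) ∧
      g ∘ₗ N.subtype ≠ 0 := by
  obtain ⟨N, ⟨⟨r, hr⟩, hgN⟩, hmin⟩ := WellFounded.has_min (wellFounded_lt (α := Submodule A M))
    {N | (∃ r : M →ₗ[A] N, r ∘ₗ N.subtype = LinearMap.id) ∧ g ∘ₗ N.subtype ≠ 0}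
    ⟨⊤, ⟨LinearMap.id.codRestrict ⊤ (fun _ => trivial), rfl⟩, fun h => hg (LinearMap.ext fun x =>
      LinearMap.congr_fun h ⟨x, trivial⟩)⟩
  have hr' : ∀ x : N, r x = x := fun x => LinearMap.congr_fun hr x
  refine ⟨N, ⟨?_, ?_⟩, ⟨r, hr⟩, hgN⟩
  · by_contra h
    rw [not_nontrivial_iff_subsingleton] at h
    exact hgN (LinearMap.ext fun x => by rw [Subsingleton.elim x 0, map_zero, map_zero])
  · rintro X Y _ _ _ _ ⟨Φ⟩
    have aux : ∀ (Z : Type) [AddCommGroup Z] [Module A Z] (i : Z →ₗ[A] N) (p : N →ₗ[A] Z),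
        p ∘ₗ i = LinearMap.id → g ∘ₗ N.subtype ∘ₗ i ≠ 0 → Function.Surjective i := by
      intro Z _ _ i p hpi hgi
      have hpi' : ∀ z, p (i z) = z := fun z => LinearMap.congr_fun hpi z
      have h1 : ¬ (LinearMap.range (N.subtype ∘ₗ i) < N) := by
        apply hmin
        refine ⟨⟨(N.subtype ∘ₗ i).rangeRestrict ∘ₗ p ∘ₗ r, ?_⟩, ?_⟩
        · refine LinearMap.ext ?_
          rintro ⟨_, z, rfl⟩
          apply Subtype.ext
          change ((i (p (r (i z : M)))) : M) = i z
          rw [hr', hpi']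
        · intro h0
          apply hgi
          refine LinearMap.ext fun z => ?_
          exact LinearMap.congr_fun h0 ⟨_, z, rfl⟩
      have h2 : LinearMap.range (N.subtype ∘ₗ i) ≤ N := by
        rintro _ ⟨z, rfl⟩
        exact (i z).2
      have h3 : N ≤ LinearMap.range (N.subtype ∘ₗ i) := by
        by_contra h3
        exact h1 (lt_of_le_not_ge h2 h3)
      intro x
      obtain ⟨z, hz⟩ := h3 x.2
      exact ⟨z, Subtype.ext hz⟩
    by_cases hX : g ∘ₗ N.subtype ∘ₗ (Φ.symm.toLinearMap ∘ₗ LinearMap.inl A X Y) = 0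
    · by_cases hY : g ∘ₗ N.subtype ∘ₗ (Φ.symm.toLinearMap ∘ₗ LinearMap.inr A X Y) = 0
      · exfalso
        apply hgN
        refine LinearMap.ext fun x => ?_
        have h1 : x = Φ.symm (LinearMap.inl A X Y (Φ x).1) + Φ.symm (LinearMap.inr A X Y (Φ x).2) := by
          rw [← map_add]
          simp
        rw [h1, map_add]
        have h2 := LinearMap.congr_fun hX (Φ x).1
        have h3 := LinearMap.congr_fun hY (Φ x).2
        simp only [LinearMap.comp_apply, LinearEquiv.coe_coe, LinearMap.zero_apply] at h2 h3 ⊢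
        rw [h2, h3, add_zero]
      · left
        have := aux Y _ (LinearMap.snd A X Y ∘ₗ Φ.toLinearMap) (by ext y; simp) hY
        refine ⟨fun x x' => ?_⟩
        have h0 : ∀ x : X, x = 0 := by
          intro x
          obtain ⟨y, hy⟩ := this (Φ.symm (x, 0))
          have := congrArg Prod.fst (Φ.symm.injective hy)
          exact this.symm
        rw [h0 x, h0 x']
    · right
      have := aux X _ (LinearMap.fst A X Y ∘ₗ Φ.toLinearMap) (by ext y; simp) hX
      refine ⟨fun x x' => ?_⟩
      have h0 : ∀ x : Y, x = 0 := by
        intro x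
        obtain ⟨y, hy⟩ := this (Φ.symm (0, x))
        have := congrArg Prod.snd (Φ.symm.injective hy)
        exact this.symm
      rw [h0 x, h0 x']

lemma Sc_card_le [IsNoetherianRing A] [IsArtinianRing A] [Finite (Ind A A)] :
    Nat.card (Sc A) ≤ Nat.card (Ind A A) := by
  have h1 : ∀ s : Sc A, ∃ g : A →ₗ[A] s.out.1, g ≠ 0 := by
    intro s
    have := s.out.2
    have := IsSimpleModule.nontrivial A s.out.1
    obtain ⟨x, hx⟩ := exists_ne (0 : s.out.1)
    refine ⟨LinearMap.toSpanSingleton A _ x, fun h0 => hx ?_⟩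
    have := LinearMap.congr_fun h0 1
    simpa using this
  choose g hg using h1
  have h2 : ∀ s : Sc A, ∃ N : Submodule A A, isIndec A N ∧
      (∃ r : A →ₗ[A] N, r ∘ₗ N.subtype = LinearMap.id) ∧ g s ∘ₗ N.subtype ≠ 0 :=
    fun s => exists_indec (g s) (hg s)
  choose N hN hr' hgN using h2
  choose r hr using hr'
  have hinj : Function.Injective (fun s : Sc A => (Quotient.mk (isoSetoid A (fun N => isIndec A ↥N ∧
    ∃ (s : ↥N →ₗ[A] A) (r : A →ₗ[A] ↥N), r.comp s = LinearMap.id))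
      ⟨ModuleCat.of A (N s), hN s, (N s).subtype, r s, hr s⟩ : Ind A A)) := by
    intro s t hst
    obtain ⟨e⟩ : Nonempty (N s ≃ₗ[A] N t) := Quotient.exact hst
    have : Module.Projective A (N s) := Module.Projective.of_split _ _ (hr s)
    have := s.out.2
    have := t.out.2
    have h2 : (g t ∘ₗ (N t).subtype) ∘ₗ e.toLinearMap ≠ 0 := by
      intro h0
      apply hgN t
      refine LinearMap.ext fun x => ?_
      have := LinearMap.congr_fun h0 (e.symm x)
      simpa using this
    obtain ⟨e'⟩ := same_top (hN s) _ _ (hgN s) h2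
    rw [← Quotient.out_eq s, ← Quotient.out_eq t]
    exact Quotient.sound ⟨e'⟩
  exact Nat.card_le_card_of_injective _ hinj

lemma additive_vanish (I : TwoSidedIdeal A)
    (F : ∀ (X : Type) [AddCommGroup X] [Module A X], ℚ)
    (hF0 : ∀ (X : Type) [AddCommGroup X] [Module A X], Subsingleton X → F X = 0)
    (hFadd : ∀ (X : Type) [AddCommGroup X] [Module A X] (N : Submodule A X), Module.Finite A X →
      Kld I X → F X = F N + F (X ⧸ N))
    (hFs : ∀ (X : Type) [AddCommGroup X] [Module A X], IsSimpleModule A X → Kld I X → F X = 0)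
    {X : Type} [AddCommGroup X] [Module A X] (h : IsFiniteLength A X) (hX : Kld I X) : F X = 0 := by
  induction h with
  | of_subsingleton => exact hF0 _ inferInstance
  | @of_simple_quotient M _ _ N hq hN ih =>
    have hM : IsFiniteLength A M := .of_simple_quotient hN
    have := (isFiniteLength_iff_isNoetherian_isArtinian.1 hM).1
    rw [hFadd M N inferInstance hX, ih (hX.sub N), hFs _ hq (hX.surj _ N.mkQ_surjective), add_zero]
end

section
variable {A : Type} [Ring A] [IsNoetherianRing A] [IsArtinianRing A]
variable {T : Type} [AddCommGroup T] [Module A T] [Module.Finite A T] {I : TwoSidedIdeal A}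

lemma Ind_card_le (k : Type) [Field k] [Algebra k A] [Module.Finite k A]
    (hI : ∀ a : A, a ∈ I ↔ ∀ t : T, a • t = 0)
    (hrig : ∀ (M : Type) [AddCommGroup M] [Module A M], facP A T M → EV A T M) :
    Finite (Ind A T) ∧ Nat.card (Ind A T) ≤ Nat.card {s : Sc A // Kld I s.out.1} := by
  have hTk : Kld I T := fun a ha => (hI a).1 ha
  choose s r hsr using fun q : Ind A T => q.out.2.2
  have hfin : ∀ q : Ind A T, Module.Finite A q.out.1 := fun q =>
    Module.Finite.of_surjective (r q) fun x => ⟨_, LinearMap.congr_fun (hsr q) x⟩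
  have hk : ∀ q : Ind A T, Kld I q.out.1 := fun q =>
    hTk.surj (r q) fun x => ⟨_, LinearMap.congr_fun (hsr q) x⟩
  choose n e he using fun q : Ind A T => (haveI := hfin q; Bq_cover (hk q))
  have hK : ∀ q, RP I (LinearMap.ker (e q)) := fun q =>
    RP_ker k hI (fun M _ _ hM => (hrig M hM).retract (s q) (r q) (hsr q)) (e q) (he q) (RP_Bq _)
  have hadd : ∀ (q : Ind A T) (X : Type) [AddCommGroup X] [Module A X] (N : Submodule A X), Module.Finite A X →
      Kld I X → chi k (e q) X = chi k (e q) N + chi k (e q) (X ⧸ N) :=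
    fun q X _ _ N _ hX => chi_add k (e q) (RP_Bq _) (hK q) hX N
  have hli : LinearIndependent ℚ (fun (q : Ind A T) (S : {s : Sc A // Kld I s.out.1}) =>
      (chi k (e q) S.1.out.1 : ℚ)) := by
    rw [linearIndependent_iff']
    intro t c hc j hj
    have hF : ∀ (X : Type) [AddCommGroup X] [Module A X], IsFiniteLength A X → Kld I X →
        ∑ q ∈ t, c q * (chi k (e q) X : ℚ) = 0 := by
      intro X _ _ hX hXk
      refine additive_vanish I (fun X _ _ => ∑ q ∈ t, c q * (chi k (e q) X : ℚ)) ?_ ?_ ?_ hX hXk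
      · intro X _ _ hX
        refine Finset.sum_eq_zero fun q _ => ?_
        rw [chi, hd_subsingleton, hd_subsingleton]
        simp
      · intro X _ _ N hfX hX
        rw [← Finset.sum_add_distrib]
        refine Finset.sum_congr rfl fun q _ => ?_
        rw [hadd q X N hfX hX]
        push_cast
        ring
      · intro X _ _ hs hX
        obtain ⟨f⟩ := Sc_out X hs
        have h1 := congrFun hc ⟨_, hX.inj f.toLinearMap f.injective⟩
        rw [Finset.sum_apply] at h1
        refine Eq.trans (Finset.sum_congr rfl fun q _ => ?_) h1
        rw [Pi.smul_apply, smul_eq_mul, chi, chi, hd_congr f, hd_congr f]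
    obtain ⟨X, _, _, hfX, hX, h1, h2⟩ := key k hI hrig (s j) (r j) (hsr j) j.out.2.1
    have h3 := hF X (isFiniteLength_iff_isNoetherian_isArtinian.2 ⟨inferInstance, inferInstance⟩) hX
    rw [Finset.sum_eq_single j] at h3
    · have h4 := h1 _ (e j) (RP_Bq _) (he j)
      rcases mul_eq_zero.1 h3 with h5 | h5
      · exact h5
      · exact absurd (by exact_mod_cast h5) h4
    · intro q _ hq
      rw [h2 _ _ (e q) (s q) (r q) (hsr q) q.out.2.1 ?_ (RP_Bq _) (he q)]
      · simp
      · intro h5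
        apply hq
        rw [← Quotient.out_eq q, ← Quotient.out_eq j]
        exact Quotient.sound h5
    · intro h; exact absurd hj h
  have := Sc_finite (A := A)
  have := Fintype.ofFinite {s : Sc A // Kld I s.out.1}
  have h6 : Finite (Ind A T) := hli.finite
  have := Fintype.ofFinite (Ind A T)
  refine ⟨h6, ?_⟩
  have := hli.fintype_card_le_finrank
  rwa [Module.finrank_fintype_fun_eq_card, ← Nat.card_eq_fintype_card, ← Nat.card_eq_fintype_card] at this

lemma all_killed (k : Type) [Field k] [Algebra k A] [Module.Finite k A]
    (hI : ∀ a : A, a ∈ I ↔ ∀ t : T, a • t = 0)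
    (hrig : ∀ (M : Type) [AddCommGroup M] [Module A M], facP A T M → EV A T M)
    (hnum : numIndec A T = numIndec A A)
    (S : Type) [AddCommGroup S] [Module A S] (hS : IsSimpleModule A S) : Kld I S := by
  have h1 := (Ind_card_le k hI hrig).2
  have h0 : ∀ a : A, a ∈ (⊥ : TwoSidedIdeal A) ↔ ∀ t : A, a • t = 0 := by
    intro a
    rw [TwoSidedIdeal.mem_bot]
    constructor
    · intro h t
      rw [h, zero_smul]
    · intro h
      have := h 1
      rwa [smul_eq_mul, mul_one] at this
  have h2 := (Ind_card_le (T := A) (I := ⊥) k h0 (fun M _ _ _ => EV.of_projective)).1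
  have h3 := Sc_card_le (A := A)
  have h4 : Nat.card (Ind A T) = Nat.card (Ind A A) := hnum
  obtain ⟨f⟩ := Sc_out S hS
  refine Kld.surj ?_ f.toLinearMap f.surjective
  by_contra h
  have := Sc_finite (A := A)
  have := Finite.card_subtype_lt (p := fun s : Sc A => Kld I s.out.1) h
  omega
end

end

/-- Let `T` be a `τ`-tilting module over an artin algebra `A` over the
field `k`, with `I = Ann(T)` and `Ā = A/I`.  Then the following are equivalent:
(1) `T` is a `1`-tilting `A`-module;
(2) `Ext²_A(T, X) = 0` for all `X ∈ fac(T)`;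
(3) `Ext²_A(T, D(Ā)) = 0`;
(4) `Tor₁^A(I, T) = 0`. -/
theorem tilting_iff_ext_two_vanishing
    (k A : Type) [Field k] [Ring A] [Algebra k A] [Module.Finite k A]
    (T : Type) [AddCommGroup T] [Module A T] [Module.Finite A T]
    [Module k T] [IsScalarTower k A T]
    (I : TwoSidedIdeal A) (hI : ∀ a : A, a ∈ I ↔ ∀ t : T, a • t = 0)
    (htauRigid : tauRigid A T) (hnum : numIndec A T = numIndec A A) :
    ((pdLeOne A T ∧ Subsingleton (egrp A 1 T T) ∧ numIndec A T = numIndec A A) ↔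
        (∀ (X : Type) [AddCommGroup X] [Module A X], facP A T X →
          Subsingleton (egrp A 2 T X))) ∧
    ((pdLeOne A T ∧ Subsingleton (egrp A 1 T T) ∧ numIndec A T = numIndec A A) ↔
        Subsingleton (egrp A 2 T (↥(DBar k A I)))) ∧
    ((pdLeOne A T ∧ Subsingleton (egrp A 1 T T) ∧ numIndec A T = numIndec A A) ↔
        Subsingleton (Tor1 k A (↥(rIdeal A I)) T)) := by
  have hrig : ∀ (M : Type) [AddCommGroup M] [Module A M], facP A T M → EV A T M :=
    fun M _ _ hM => (ext1_iff T M).1 (htauRigid M hM)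
  have hNoeth : IsNoetherianRing A := isNoetherian_of_tower k inferInstance
  have hArt : IsArtinianRing A := isArtinian_of_tower k inferInstance
  have hTT : Subsingleton (egrp A 1 T T) := htauRigid T facP_self
  have h31 : Subsingleton (egrp A 2 T (↥(DBar k A I))) → pdLeOne A T := fun h =>
    pd_of_ext2_DBar k T I hI hrig (fun S _ _ hS => all_killed k hI hrig hnum S hS) h
  refine ⟨⟨fun h X _ _ _ => ext2_of_pd T X h.1, fun h => ⟨h31 ?_, hTT, hnum⟩⟩,
    ⟨fun h => ext2_of_pd T _ h.1, fun h => ⟨h31 h, hTT, hnum⟩⟩,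
    ⟨fun h => tor_of_pd I T h.1, fun h => ⟨h31 (ext2_of_tor I T h), hTT, hnum⟩⟩⟩
  exact h _ (DBar_facP k T I hI).2
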